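/- arXiv:1407.0675 — 11 statements merged into one kernel-verified Lean document; each statement's English description precedes it below -/
import Mathlib

section
/- For every u ∈ l²(ℤ) one has sup_{n∈ℤ} u(n)² ≤ ‖u‖·‖Du‖, i.e. the supremum of the squares of the entries of u is bounded by the product of the l²-norm of u and the l²-norm of its difference sequence. -/
open Real

open Filter Topology in
/-- A function on `ℤ` vanishing at infinity is bounded by half of its total variation. -/
theorem two_mul_abs_le_tsum_abs_sub {f : ℤ → ℝ} (hf : Tendsto f cofinite (𝓝 0))
    (hs : Summable fun k : ℤ => |f (k + 1) - f k|) (n : ℤ) :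
    2 * |f n| ≤ ∑' k : ℤ, |f (k + 1) - f k| := by
  set g : ℤ → ℝ := fun k => |f (k + 1) - f k| with hg
  have hinj₁ : Function.Injective fun j : ℕ => n + (j : ℤ) := fun a b h => by simpa using h
  have hinj₂ : Function.Injective fun j : ℕ => n - (j : ℤ) := fun a b h => by simpa using h
  have hinj₃ : Function.Injective fun j : ℕ => n - 1 - (j : ℤ) := fun a b h => by simpa using h
  have hs₁ : Summable fun j : ℕ => g (n + j) := hs.comp_injective hinj₁
  have hs₂ : Summable fun j : ℕ => g (n - 1 - j) := hs.comp_injective hinj₃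
  have hd₁ : ∀ j : ℕ, dist (f (n + j)) (f (n + (j.succ : ℕ))) = g (n + j) := fun j => by
    rw [dist_comm, Real.dist_eq, hg]
    push_cast
    rw [add_assoc]
  have hd₂ : ∀ j : ℕ, dist (f (n - j)) (f (n - (j.succ : ℕ))) = g (n - 1 - j) := fun j => by
    have h : n - ((j.succ : ℕ) : ℤ) = n - 1 - j := by push_cast; ring
    rw [Real.dist_eq, h, hg]
    simp only [sub_right_comm n 1, sub_add_cancel]
  have h₁ : |f n| ≤ ∑' j : ℕ, g (n + j) := by
    have := dist_le_tsum_of_dist_le_of_tendsto₀ (f := fun j : ℕ => f (n + j)) _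
      (fun j => (hd₁ j).le) hs₁ (by
        have := hf.comp hinj₁.tendsto_cofinite
        rwa [Nat.cofinite_eq_atTop] at this)
    simpa using this
  have h₂ : |f n| ≤ ∑' j : ℕ, g (n - 1 - j) := by
    have := dist_le_tsum_of_dist_le_of_tendsto₀ (f := fun j : ℕ => f (n - j)) _
      (fun j => (hd₂ j).le) hs₂ (by
        have := hf.comp hinj₂.tendsto_cofinite
        rwa [Nat.cofinite_eq_atTop] at this)
    simpa using this
  have hsplit : ∑' k, g k = ∑' j : ℕ, g (n + j) + ∑' j : ℕ, g (n - 1 - j) := by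
    rw [← (Equiv.addLeft n).tsum_eq g]
    have hneg : ∀ j : ℕ, n + -((j : ℤ) + 1) = n - 1 - j := fun j => by ring
    have := tsum_of_nat_of_neg_add_one (f := fun k : ℤ => g (n + k)) hs₁
      (by simpa only [hneg] using hs₂)
    simpa only [hneg, Equiv.coe_addLeft] using this
  linarith

/-- Cauchy–Schwarz for square-summable real families. -/
theorem summable_abs_mul_and_tsum_le_sqrt_mul_sqrt {ι : Type*} {a b : ι → ℝ}
    (ha : Summable fun i => a i ^ 2) (hb : Summable fun i => b i ^ 2) :
    (Summable fun i => |a i * b i|) ∧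
      ∑' i, |a i * b i| ≤ √(∑' i, a i ^ 2) * √(∑' i, b i ^ 2) := by
  have hfin : ∀ s : Finset ι,
      ∑ i ∈ s, |a i * b i| ≤ √(∑' i, a i ^ 2) * √(∑' i, b i ^ 2) := fun s => by
    have hcs := Real.sum_mul_le_sqrt_mul_sqrt s (fun i => |a i|) (fun i => |b i|)
    simp only [sq_abs, ← abs_mul] at hcs
    refine hcs.trans ?_
    gcongr
    · exact ha.sum_le_tsum s fun i _ => sq_nonneg _
    · exact hb.sum_le_tsum s fun i _ => sq_nonneg _
  exact ⟨summable_of_sum_le (fun _ => abs_nonneg _) hfin,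
    Real.tsum_le_of_sum_le (fun _ => abs_nonneg _) hfin⟩

/-- For every `u ∈ l²(ℤ)`, `sup_n u(n)² ≤ ‖u‖ · ‖Du‖`, where
`Du(n) = u(n+1) - u(n)`. -/
theorem discrete_interpolation_1D (u : ℤ → ℝ) (hu : Summable fun n => u n ^ 2) :
    ∀ n : ℤ, u n ^ 2 ≤
      Real.sqrt (∑' n : ℤ, u n ^ 2) * Real.sqrt (∑' n : ℤ, (u (n + 1) - u n) ^ 2) := by
  intro n
  have hshift : Summable fun k : ℤ => u (k + 1) ^ 2 :=
    hu.comp_injective (add_left_injective (1 : ℤ))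
  have hshift_eq : ∑' k : ℤ, u (k + 1) ^ 2 = ∑' k : ℤ, u k ^ 2 :=
    (Equiv.addRight (1 : ℤ)).tsum_eq fun k => u k ^ 2
  have hbound : Summable fun k : ℤ => 2 * (u (k + 1) ^ 2 + u k ^ 2) :=
    (hshift.add hu).mul_left 2
  have hadd : Summable fun k : ℤ => (u (k + 1) + u k) ^ 2 :=
    hbound.of_nonneg_of_le (fun _ => sq_nonneg _)
      fun k => by nlinarith [sq_nonneg (u (k + 1) - u k)]
  have hsub : Summable fun k : ℤ => (u (k + 1) - u k) ^ 2 :=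
    hbound.of_nonneg_of_le (fun _ => sq_nonneg _)
      fun k => by nlinarith [sq_nonneg (u (k + 1) + u k)]
  have hadd_le : √(∑' k : ℤ, (u (k + 1) + u k) ^ 2) ≤ 2 * √(∑' k : ℤ, u k ^ 2) := by
    have h : ∑' k : ℤ, (u (k + 1) + u k) ^ 2 ≤ 2 ^ 2 * ∑' k : ℤ, u k ^ 2 := by
      calc ∑' k : ℤ, (u (k + 1) + u k) ^ 2
          ≤ ∑' k : ℤ, 2 * (u (k + 1) ^ 2 + u k ^ 2) :=
            hadd.tsum_le_tsum (fun k => by nlinarith [sq_nonneg (u (k + 1) - u k)]) hbound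
        _ = 2 ^ 2 * ∑' k : ℤ, u k ^ 2 := by
            rw [tsum_mul_left, hshift.tsum_add hu, hshift_eq]
            ring
    calc √(∑' k : ℤ, (u (k + 1) + u k) ^ 2) ≤ √(2 ^ 2 * ∑' k : ℤ, u k ^ 2) :=
          Real.sqrt_le_sqrt h
      _ = 2 * √(∑' k : ℤ, u k ^ 2) := by
          rw [Real.sqrt_mul (by positivity), Real.sqrt_sq (by positivity)]
  obtain ⟨hsum, hle⟩ := summable_abs_mul_and_tsum_le_sqrt_mul_sqrt hadd hsub
  simp only [← sq_sub_sq] at hsum hle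
  have hvar := two_mul_abs_le_tsum_abs_sub hu.tendsto_cofinite_zero hsum n
  rw [abs_of_nonneg (sq_nonneg _)] at hvar
  have hmul := mul_le_mul_of_nonneg_right hadd_le
    (Real.sqrt_nonneg (∑' k : ℤ, (u (k + 1) - u k) ^ 2))
  linarith
end

section
/- For every d ∈ (0,4), the supremum V(d) := sup{ u(0)² : u ∈ l²(ℤ), ‖u‖² = 1, ‖Du‖² = d } equals (1/2)·√(d(4−d)), and this supremum is attained. -/
open Real

/-- A square-summable sequence on `ℤ` satisfies a resolvent-type bound for its value at `0`. -/
lemma one_sub_sq_mul_sq_apply_zero_le {u : ℤ → ℝ} {m d : ℝ}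
    (hu : HasSum (fun n => u n ^ 2) m)
    (hD : HasSum (fun n : ℤ => (u (n + 1) - u n) ^ 2) d) (r : ℝ) :
    (1 - r ^ 2) * u 0 ^ 2 ≤ (1 + r ^ 2) * m + r * (d - 2 * m) := by
  have hshift : ∀ {f : ℤ → ℝ} {a : ℝ}, HasSum f a → HasSum (fun n => f (n + 1)) a :=
    fun h => (Equiv.addRight (1 : ℤ)).hasSum_iff.mpr h
  have hs := hu.summable
  let α : ℤ → ℝ := fun n => if 0 ≤ n then r ^ 2 else 1
  let β : ℤ → ℝ := fun n => if 1 ≤ n then 1 else r ^ 2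
  have hbdd : ∀ w : ℤ → ℝ, (∀ n, w n = r ^ 2 ∨ w n = 1) →
      Summable (fun n => w n * u n ^ 2) := by
    intro w hw
    refine Summable.of_nonneg_of_le (fun n => ?_) (fun n => ?_) (hs.mul_left (1 + r ^ 2))
    · rcases hw n with h | h <;> rw [h] <;> positivity
    · rcases hw n with h | h <;> rw [h] <;> nlinarith [sq_nonneg (u n), sq_nonneg (r * u n)]
  obtain ⟨a, ha⟩ := hbdd α (fun n => by simp only [α]; split_ifs <;> simp)
  obtain ⟨b, hb⟩ := hbdd β (fun n => by simp only [β]; split_ifs <;> simp)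
  have hab : a + b = (1 + r ^ 2) * m + (r ^ 2 - 1) * u 0 ^ 2 := by
    refine (ha.add hb).unique ?_
    convert (hu.mul_left (1 + r ^ 2)).add (hasSum_ite_eq (0 : ℤ) ((r ^ 2 - 1) * u 0 ^ 2))
      using 1
    · rfl
    funext n
    simp only [α, β]
    rcases lt_trichotomy n 0 with h | h | h
    · rw [if_neg (by lia), if_neg (by lia), if_neg (by lia)]; ring
    · subst h; norm_num; ring
    · rw [if_pos (by lia), if_pos (by lia), if_neg (by lia)]; ring
  have key := ((ha.add (hshift hb)).add ((hD.sub (hu.add (hshift hu))).mul_left r)).nonneg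
    (fun n => by
      simp only [α, β]
      by_cases h : 0 ≤ n
      · rw [if_pos h, if_pos (by lia)]
        nlinarith [sq_nonneg (r * u n - u (n + 1))]
      · rw [if_neg h, if_neg (by lia)]
        nlinarith [sq_nonneg (u n - r * u (n + 1))])
  linarith

lemma hasSum_pow_natAbs {q : ℝ} (h0 : 0 ≤ q) (h1 : q < 1) :
    HasSum (fun n : ℤ => q ^ n.natAbs) ((1 + q) / (1 - q)) := by
  have hg := hasSum_geometric_of_lt_one h0 h1
  have h := HasSum.of_nat_of_neg_add_one (f := fun n : ℤ => q ^ n.natAbs)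
    (m := (1 - q)⁻¹) (m' := q * (1 - q)⁻¹) (by simpa using hg) (by
      convert hg.mul_left q using 1
      · rfl
      funext n
      rw [show (-((n : ℤ) + 1)).natAbs = n + 1 by lia, pow_succ'])
  convert h using 1
  ring

lemma hasSum_sq_sub_pow_natAbs {r : ℝ} (hr : r ^ 2 < 1) :
    HasSum (fun n : ℤ => (r ^ (n + 1).natAbs - r ^ n.natAbs) ^ 2)
      (2 * (1 - r) ^ 2 / (1 - r ^ 2)) := by
  have hg := (hasSum_geometric_of_lt_one (sq_nonneg r) hr).mul_left ((1 - r) ^ 2)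
  have h := HasSum.of_nat_of_neg_add_one
    (f := fun n : ℤ => (r ^ (n + 1).natAbs - r ^ n.natAbs) ^ 2)
    (m := (1 - r) ^ 2 * (1 - r ^ 2)⁻¹) (m' := (1 - r) ^ 2 * (1 - r ^ 2)⁻¹) (by
      convert hg using 1
      · rfl
      funext n
      rw [show ((n : ℤ) + 1).natAbs = n + 1 by lia, Int.natAbs_natCast]
      ring) (by
      convert hg using 1
      · rfl
      funext n
      rw [show (-((n : ℤ) + 1) + 1).natAbs = n by lia,
        show (-((n : ℤ) + 1)).natAbs = n + 1 by lia]
      ring)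
  convert h using 1
  ring

/-- For `d ∈ (0,4)`,
`V(d) = sup { u(0)² : u ∈ l²(ℤ), ‖u‖² = 1, ‖Du‖² = d } = (1/2)√(d(4-d))`,
and the supremum is attained. -/
theorem V_eq_half_sqrt (d : ℝ) (hd : d ∈ Set.Ioo (0 : ℝ) 4) :
    IsGreatest
      {v : ℝ | ∃ u : ℤ → ℝ, Summable (fun n => u n ^ 2) ∧
        (∑' n : ℤ, u n ^ 2) = 1 ∧ (∑' n : ℤ, (u (n + 1) - u n) ^ 2) = d ∧ v = u 0 ^ 2}
      ((1 / 2) * Real.sqrt (d * (4 - d))) := by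
  obtain ⟨hd0, hd4⟩ := hd
  have hpos : 0 < d * (4 - d) := mul_pos hd0 (by linarith)
  set s := (1 / 2) * Real.sqrt (d * (4 - d)) with hs_def
  have hs : 0 < s := by positivity
  have hs2 : s ^ 2 = d * (4 - d) / 4 := by
    rw [hs_def, mul_pow, Real.sq_sqrt hpos.le]; ring
  have hs1 : 1 + s ≠ 0 := by positivity
  obtain ⟨r, hr⟩ : ∃ r, r = (2 - d) / 2 / (1 + s) := ⟨_, rfl⟩
  have hr2 : r ^ 2 = (1 - s) / (1 + s) := by
    rw [hr]; field_simp; linear_combination 4 * hs2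
  have hsub : 1 - r ^ 2 = 2 * s / (1 + s) := by rw [hr2]; field_simp; ring
  have hadd : 1 + r ^ 2 = 2 / (1 + s) := by rw [hr2]; field_simp; ring
  have hlt : r ^ 2 < 1 := by
    have : 0 < 2 * s / (1 + s) := by positivity
    linarith
  constructor
  · have hsq : √s ^ 2 = s := Real.sq_sqrt hs.le
    have h1 : HasSum (fun n : ℤ => (√s * r ^ n.natAbs) ^ 2) 1 := by
      convert (hasSum_pow_natAbs (sq_nonneg r) hlt).mul_left s using 1
      · rfl
      · funext n
        rw [mul_pow, hsq, ← pow_mul, ← pow_mul, mul_comm 2]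
      · rw [hsub, hadd]; field_simp
    have h2 : HasSum (fun n : ℤ => (√s * r ^ (n + 1).natAbs - √s * r ^ n.natAbs) ^ 2) d := by
      convert (hasSum_sq_sub_pow_natAbs hlt).mul_left s using 1
      · rfl
      · funext n
        rw [← mul_sub, mul_pow, hsq]
      · have : (1 - r) ^ 2 = d / (1 + s) := by
          rw [show (1 - r) ^ 2 = 1 + r ^ 2 - 2 * r by ring, hadd, hr]; field_simp; ring
        rw [this, hsub]; field_simp
    exact ⟨fun n => √s * r ^ n.natAbs, h1.summable, h1.tsum_eq, h2.tsum_eq, by simp [hsq]⟩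
  · rintro v ⟨u, hu, hu1, huD, rfl⟩
    have hshift : Summable (fun n => u (n + 1) ^ 2) :=
      (Equiv.addRight (1 : ℤ)).summable_iff.mpr hu
    have hD : Summable (fun n : ℤ => (u (n + 1) - u n) ^ 2) :=
      Summable.of_nonneg_of_le (fun n => sq_nonneg _)
        (fun n => by nlinarith [sq_nonneg (u (n + 1) + u n)]) ((hshift.add hu).mul_left 2)
    have key := one_sub_sq_mul_sq_apply_zero_le (hu1 ▸ hu.hasSum) (huD ▸ hD.hasSum) r
    have e : (1 + r ^ 2) * 1 + r * (d - 2 * 1) = 2 * s / (1 + s) * s := by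
      rw [hadd, hr]; field_simp; linear_combination (-4) * hs2
    rw [e, hsub] at key
    exact le_of_mul_le_mul_left key (by positivity)
end

section
/- For every nonzero u ∈ l²(ℤ) the refined interpolation inequality u(0)² ≤ (1/2)·√(4 − ‖Du‖²/‖u‖²)·‖u‖·‖Du‖ holds. -/
open Real

/-- Products of two square-summable families are summable. -/
lemma summable_mul_of_summable_sq {ι : Type*} {v w : ι → ℝ} (hv : Summable fun n => v n ^ 2)
    (hw : Summable fun n => w n ^ 2) : Summable fun n => v n * w n := by
  refine Summable.of_norm_bounded (hv.add hw) fun n => ?_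
  rw [Real.norm_eq_abs, abs_le]
  constructor <;> nlinarith [sq_nonneg (v n + w n), sq_nonneg (v n - w n)]

/-- The Cauchy–Schwarz inequality for square-summable families. -/
lemma sq_tsum_mul_le {ι : Type*} {v w : ι → ℝ} (hv : Summable fun n => v n ^ 2)
    (hw : Summable fun n => w n ^ 2) :
    (∑' n, v n * w n) ^ 2 ≤ (∑' n, v n ^ 2) * ∑' n, w n ^ 2 := by
  have hvw := summable_mul_of_summable_sq hv hw
  have key : ∀ t : ℝ, 0 ≤ (∑' n, v n ^ 2) * (t * t) + (2 * ∑' n, v n * w n) * t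
      + ∑' n, w n ^ 2 := by
    intro t
    have h := ((hv.hasSum.mul_right (t * t)).add
      ((hvw.hasSum.mul_left 2).mul_right t)).add hw.hasSum
    refine h.nonneg fun n => ?_
    nlinarith [sq_nonneg (v n * t + w n)]
  have := discrim_le_zero key
  rw [discrim] at this
  linarith

/-- Cauchy–Schwarz for a one-sided sequence and its shift. -/
lemma sq_tsum_mul_succ_le {v : ℕ → ℝ} (hv : Summable fun n => v n ^ 2) :
    (∑' n, v n * v (n + 1)) ^ 2 ≤ (v 0 ^ 2 + ∑' n, v (n + 1) ^ 2) * ∑' n, v (n + 1) ^ 2 := by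
  rw [← hv.tsum_eq_zero_add]
  exact sq_tsum_mul_le hv ((summable_nat_add_iff 1).2 hv)

lemma sq_add_sq_le_of_sq_le {a p q c d : ℝ} (ha : 0 ≤ a) (hp : 0 ≤ p) (hq : 0 ≤ q)
    (hc : c ^ 2 ≤ (a + p) * p) (hd : d ^ 2 ≤ (a + q) * q) :
    a ^ 2 + (c + d) ^ 2 ≤ (a + p + q) ^ 2 := by
  have h : 2 * (c * d) ≤ (a + p) * q + (a + q) * p := by
    refine le_of_sq_le_sq ?_ (by positivity)
    have := mul_le_mul hc hd (sq_nonneg d) (by positivity)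
    nlinarith [sq_nonneg ((a + p) * q - (a + q) * p)]
  nlinarith

/-- The value at `0` and the autocorrelation at lag one of a square-summable sequence. -/
lemma pow_four_add_sq_tsum_mul_succ_le {u : ℤ → ℝ} (hu : Summable fun n => u n ^ 2) :
    (u 0 ^ 2) ^ 2 + (∑' n : ℤ, u n * u (n + 1)) ^ 2 ≤ (∑' n : ℤ, u n ^ 2) ^ 2 := by
  have hr : Summable fun n : ℕ => u n ^ 2 := hu.comp_injective Nat.cast_injective
  have hl : Summable fun n : ℕ => u (-n) ^ 2 :=
    hu.comp_injective (neg_injective.comp Nat.cast_injective)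
  have hl' : Summable fun n : ℕ => u (-(n + 1)) ^ 2 := by
    simpa using (summable_nat_add_iff 1).2 hl
  have hs : Summable fun n : ℤ => u (n + 1) ^ 2 := hu.comp_injective (add_left_injective 1)
  have hm := summable_mul_of_summable_sq hu hs
  have hmr : Summable fun n : ℕ => u n * u (n + 1) := hm.comp_injective Nat.cast_injective
  have hml : Summable fun n : ℕ => u (-(n + 1)) * u (-(n + 1) + 1) :=
    hm.comp_injective (i := fun n : ℕ => (-(n + 1) : ℤ)) fun a b h => by
      simp only [neg_inj, add_left_inj, Nat.cast_inj] at h; exact h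
  have hA := tsum_of_nat_of_neg_add_one (f := fun n : ℤ => u n ^ 2) hr hl'
  have hC := tsum_of_nat_of_neg_add_one (f := fun n : ℤ => u n * u (n + 1)) hmr hml
  rw [hr.tsum_eq_zero_add] at hA
  rw [hA, hC]
  have h₁ := sq_tsum_mul_succ_le (v := fun n : ℕ => u n) hr
  have h₂ := sq_tsum_mul_succ_le (v := fun n : ℕ => u (-n)) hl
  have e : ∀ n : ℕ, u (-(n + 1)) * u (-(n + 1) + 1) = u (-n) * u (-(n + 1)) := fun n => by
    rw [mul_comm, neg_add_rev, neg_add_cancel_comm]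
  simp only [Nat.cast_add, Nat.cast_one, Nat.cast_zero, neg_zero] at h₁ h₂ ⊢
  simp only [e]
  exact sq_add_sq_le_of_sq_le (sq_nonneg _) (tsum_nonneg fun _ => sq_nonneg _)
    (tsum_nonneg fun _ => sq_nonneg _) h₁ h₂

lemma tsum_sub_succ_sq {u : ℤ → ℝ} (hu : Summable fun n => u n ^ 2) :
    ∑' n : ℤ, (u (n + 1) - u n) ^ 2 = 2 * ∑' n : ℤ, u n ^ 2 - 2 * ∑' n : ℤ, u n * u (n + 1) := by
  have hs : Summable fun n : ℤ => u (n + 1) ^ 2 := hu.comp_injective (add_left_injective 1)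
  have e : ∑' n : ℤ, u (n + 1) ^ 2 = ∑' n : ℤ, u n ^ 2 :=
    (Equiv.addRight (1 : ℤ)).tsum_eq fun n => u n ^ 2
  have h := ((hs.hasSum.add hu.hasSum).sub
    ((summable_mul_of_summable_sq hu hs).hasSum.mul_left 2)).tsum_eq
  rw [e] at h
  rw [two_mul (∑' n : ℤ, u n ^ 2), ← h]
  exact tsum_congr fun n => by ring

/-- Refined interpolation inequality:
`u(0)² ≤ (1/2) √(4 - ‖Du‖²/‖u‖²) ‖u‖ ‖Du‖` for nonzero `u ∈ l²(ℤ)`. -/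
theorem refined_interpolation_1D (u : ℤ → ℝ) (hu : Summable fun n => u n ^ 2)
    (hne : u ≠ 0) :
    u 0 ^ 2 ≤
      (1 / 2) * Real.sqrt (4 - (∑' n : ℤ, (u (n + 1) - u n) ^ 2) / (∑' n : ℤ, u n ^ 2)) *
        Real.sqrt (∑' n : ℤ, u n ^ 2) * Real.sqrt (∑' n : ℤ, (u (n + 1) - u n) ^ 2) := by
  have hA : 0 < ∑' n : ℤ, u n ^ 2 := by
    obtain ⟨m, hm⟩ := Function.ne_iff.1 hne
    exact hu.tsum_pos (fun _ => sq_nonneg _) m (sq_pos_of_ne_zero hm)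
  have key := pow_four_add_sq_tsum_mul_succ_le hu
  rw [tsum_sub_succ_sq hu]
  set A := ∑' n : ℤ, u n ^ 2
  set C := ∑' n : ℤ, u n * u (n + 1)
  have hC : -A ≤ C := (abs_le_of_sq_le_sq' (by nlinarith [sq_nonneg (u 0 ^ 2)]) hA.le).1
  have hS : 0 ≤ 4 - (2 * A - 2 * C) / A := by
    rw [sub_nonneg, div_le_iff₀ hA]
    linarith
  have hSA : (4 - (2 * A - 2 * C) / A) * A = 2 * A + 2 * C := by
    field_simp
    ring
  rw [mul_assoc (1 / 2 : ℝ), mul_assoc (1 / 2 : ℝ), ← Real.sqrt_mul hS, hSA,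
    ← Real.sqrt_mul (by linarith)]
  have := Real.le_sqrt_of_sq_le (x := 2 * u 0 ^ 2) (y := (2 * A + 2 * C) * (2 * A - 2 * C))
    (by nlinarith)
  linarith
end

section
/- For every θ ∈ [0, 1/2) and every constant C > 0 there exists a nonzero u ∈ l²(ℤ) with u(0)² > C·‖u‖^{2θ}·‖Du‖^{2(1−θ)}; that is, the interpolation inequality u(0)² ≤ C·‖u‖^{2θ}·‖Du‖^{2(1−θ)} fails for every finite constant when θ < 1/2. -/
open Real

theorem hasSum_sq_pow_natAbs {r : ℝ} (h0 : 0 ≤ r) (h1 : r < 1) :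
    HasSum (fun n : ℤ => (r ^ n.natAbs) ^ 2) ((1 - r ^ 2)⁻¹ + r ^ 2 * (1 - r ^ 2)⁻¹) := by
  have hg : HasSum (fun n : ℕ => (r ^ 2) ^ n) (1 - r ^ 2)⁻¹ :=
    hasSum_geometric_of_lt_one (sq_nonneg r) (by nlinarith)
  refine HasSum.of_nat_of_neg_add_one ?_ ?_
  · refine (congrArg (HasSum · _) (funext fun n => ?_)).mp hg
    simp only [Int.natAbs_natCast]
    ring
  · refine (congrArg (HasSum · _) (funext fun n => ?_)).mp (hg.mul_left (r ^ 2))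
    have : (-((n : ℤ) + 1)).natAbs = n + 1 := by omega
    rw [this]
    ring

theorem hasSum_sq_diff_pow_natAbs {r : ℝ} (h0 : 0 ≤ r) (h1 : r < 1) :
    HasSum (fun n : ℤ => (r ^ (n + 1).natAbs - r ^ n.natAbs) ^ 2)
      ((1 - r) ^ 2 * (1 - r ^ 2)⁻¹ + (1 - r) ^ 2 * (1 - r ^ 2)⁻¹) := by
  have hg : HasSum (fun n : ℕ => (r ^ 2) ^ n) (1 - r ^ 2)⁻¹ :=
    hasSum_geometric_of_lt_one (sq_nonneg r) (by nlinarith)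
  refine HasSum.of_nat_of_neg_add_one ?_ ?_
  · refine (congrArg (HasSum · _) (funext fun n => ?_)).mp (hg.mul_left ((1 - r) ^ 2))
    have h : ((n : ℤ) + 1).natAbs = n + 1 := by omega
    rw [h, Int.natAbs_natCast]
    ring
  · refine (congrArg (HasSum · _) (funext fun n => ?_)).mp (hg.mul_left ((1 - r) ^ 2))
    have h : (-((n : ℤ) + 1)).natAbs = n + 1 := by omega
    have h' : (-((n : ℤ) + 1) + 1).natAbs = n := by omega
    rw [h, h']
    ring

/-- For `θ ∈ [0,1/2)` the interpolation inequality
`u(0)² ≤ C ‖u‖^(2θ) ‖Du‖^(2(1-θ))` fails for every constant `C > 0`. -/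
theorem interpolation_fails_below_half (θ : ℝ) (hθ : θ ∈ Set.Ico (0 : ℝ) (1 / 2))
    (C : ℝ) (hC : 0 < C) :
    ∃ u : ℤ → ℝ, Summable (fun n => u n ^ 2) ∧ u ≠ 0 ∧
      C * (∑' n : ℤ, u n ^ 2) ^ θ * (∑' n : ℤ, (u (n + 1) - u n) ^ 2) ^ (1 - θ)
        < u 0 ^ 2 := by
  obtain ⟨hθ0, hθ1⟩ := hθ
  obtain ⟨ε, hε0, hε1, hε⟩ : ∃ ε : ℝ, 0 < ε ∧ ε < 1 ∧ 2 * C * ε ^ (1 - 2 * θ) < 1 := by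
    have hp : 0 < 1 - 2 * θ := by linarith
    have ht : Filter.Tendsto (fun ε : ℝ => 2 * C * ε ^ (1 - 2 * θ)) (nhdsWithin 0 (Set.Ioi 0))
        (nhds 0) := by
      have := ((continuousAt_rpow_const 0 (1 - 2 * θ) (Or.inr hp.le)).tendsto.const_mul
        (2 * C)).mono_left (nhdsWithin_le_nhds (s := Set.Ioi 0))
      simpa [zero_rpow hp.ne'] using this
    obtain ⟨ε, h, h0, h1⟩ := ((ht.eventually_lt_const one_pos).and
      (Ioo_mem_nhdsGT (zero_lt_one' ℝ))).exists
    exact ⟨ε, h0, h1, h⟩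
  have hr0 : 0 ≤ 1 - ε := by linarith
  have hr1 : 1 - ε < 1 := by linarith
  have hd : 0 < 1 - (1 - ε) ^ 2 := by nlinarith
  have hu := hasSum_sq_pow_natAbs hr0 hr1
  have hDu := hasSum_sq_diff_pow_natAbs hr0 hr1
  refine ⟨fun n => (1 - ε) ^ n.natAbs, hu.summable, fun h => ?_, ?_⟩
  · simpa using congrFun h 0
  rw [hu.tsum_eq, hDu.tsum_eq]
  have hA : (1 - (1 - ε) ^ 2)⁻¹ + (1 - ε) ^ 2 * (1 - (1 - ε) ^ 2)⁻¹ ≤ 2 * ε⁻¹ := by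
    rw [← one_add_mul, ← div_eq_mul_inv, ← div_eq_mul_inv, div_le_div_iff₀ hd hε0]
    nlinarith [mul_pos hε0 hε0, mul_pos (mul_pos hε0 hε0) hε0]
  have hB : (1 - (1 - ε)) ^ 2 * (1 - (1 - ε) ^ 2)⁻¹ + (1 - (1 - ε)) ^ 2 * (1 - (1 - ε) ^ 2)⁻¹
      ≤ 2 * ε := by
    rw [← two_mul, ← div_eq_mul_inv]
    refine mul_le_mul_of_nonneg_left ?_ two_pos.le
    rw [div_le_iff₀ hd]
    nlinarith [mul_pos hε0 hε0]
  have hθ' : 0 ≤ 1 - θ := by linarith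
  calc _ ≤ C * (2 * ε⁻¹) ^ θ * (2 * ε) ^ (1 - θ) := by gcongr
    _ = 2 * C * ε ^ (1 - 2 * θ) := by
      have h2 : (2 : ℝ) ^ θ * 2 ^ (1 - θ) = 2 := by
        rw [← rpow_add two_pos, add_sub_cancel, rpow_one]
      have h3 : (ε⁻¹) ^ θ * ε ^ (1 - θ) = ε ^ (1 - 2 * θ) := by
        rw [inv_rpow hε0.le, ← rpow_neg hε0.le, ← rpow_add hε0]
        congr 1
        ring
      rw [mul_rpow two_pos.le (inv_nonneg.2 hε0.le), mul_rpow two_pos.le hε0.le, ← h3]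
      linear_combination C * (ε⁻¹) ^ θ * ε ^ (1 - θ) * h2
    _ < _ := by simpa using hε
end

section
/- Define V(d) := sup{ u(0)² : u ∈ l²(ℤ), ‖u‖² = 1, ‖Du‖² = d } for d ∈ (0,4). Then V satisfies the symmetry V(d) = V(4−d) for all d ∈ (0,4). -/
open Real

theorem neg_one_zpow_sq (n : ℤ) : ((-1 : ℝ) ^ n) ^ 2 = 1 := by
  rw [← zpow_natCast, zpow_comm]
  norm_num

theorem alternate_sq (u : ℤ → ℝ) (n : ℤ) : ((-1 : ℝ) ^ n * u n) ^ 2 = u n ^ 2 := by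
  rw [mul_pow, neg_one_zpow_sq, one_mul]

/-- Alternating the signs of a sequence replaces `‖Du‖²` by `4‖u‖² - ‖Du‖²`. -/
theorem tsum_sq_diff_alternate {u : ℤ → ℝ} (hu : Summable fun n => u n ^ 2) :
    ∑' n : ℤ, ((-1 : ℝ) ^ (n + 1) * u (n + 1) - (-1 : ℝ) ^ n * u n) ^ 2 =
      4 * ∑' n : ℤ, u n ^ 2 - ∑' n : ℤ, (u (n + 1) - u n) ^ 2 := by
  have hs : Summable fun n : ℤ => u (n + 1) ^ 2 :=
    (Equiv.addRight (1 : ℤ)).summable_iff.mpr hu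
  have hts : ∑' n : ℤ, u (n + 1) ^ 2 = ∑' n : ℤ, u n ^ 2 :=
    (Equiv.addRight (1 : ℤ)).tsum_eq fun n => u n ^ 2
  have hsum : Summable fun n : ℤ => 2 * u (n + 1) ^ 2 + 2 * u n ^ 2 :=
    (hs.mul_left 2).add (hu.mul_left 2)
  have hD : Summable fun n : ℤ => (u (n + 1) - u n) ^ 2 :=
    hsum.of_nonneg_of_le (fun n => sq_nonneg _)
      fun n => by nlinarith [sq_nonneg (u (n + 1) + u n)]
  have hpt (n : ℤ) : ((-1 : ℝ) ^ (n + 1) * u (n + 1) - (-1 : ℝ) ^ n * u n) ^ 2 =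
      2 * u (n + 1) ^ 2 + 2 * u n ^ 2 - (u (n + 1) - u n) ^ 2 := by
    rw [zpow_add_one₀ (by norm_num)]
    linear_combination (u (n + 1) + u n) ^ 2 * neg_one_zpow_sq n
  simp_rw [hpt]
  rw [hsum.tsum_sub hD, (hs.mul_left 2).tsum_add (hu.mul_left 2), tsum_mul_left,
    tsum_mul_left, hts]
  ring

theorem exists_alternate {d v : ℝ}
    (h : ∃ u : ℤ → ℝ, Summable (fun n => u n ^ 2) ∧
      (∑' n : ℤ, u n ^ 2) = 1 ∧ (∑' n : ℤ, (u (n + 1) - u n) ^ 2) = d ∧ v = u 0 ^ 2) :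
    ∃ u : ℤ → ℝ, Summable (fun n => u n ^ 2) ∧
      (∑' n : ℤ, u n ^ 2) = 1 ∧ (∑' n : ℤ, (u (n + 1) - u n) ^ 2) = 4 - d ∧
      v = u 0 ^ 2 := by
  obtain ⟨u, hu, hu1, hud, hv⟩ := h
  refine ⟨fun n => (-1 : ℝ) ^ n * u n, ?_, ?_, ?_, ?_⟩
  · simpa only [alternate_sq] using hu
  · simpa only [alternate_sq] using hu1
  · rw [tsum_sq_diff_alternate hu, hu1, hud, mul_one]
  · simpa only [alternate_sq] using hv

/-- Symmetry of `V(d) := sup { u(0)² : u ∈ l²(ℤ), ‖u‖² = 1, ‖Du‖² = d }`: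
for all `d ∈ (0,4)`, `V(d) = V(4-d)`. -/
theorem V_symmetry (d : ℝ) (hd : d ∈ Set.Ioo (0 : ℝ) 4) :
    sSup {v : ℝ | ∃ u : ℤ → ℝ, Summable (fun n => u n ^ 2) ∧
        (∑' n : ℤ, u n ^ 2) = 1 ∧ (∑' n : ℤ, (u (n + 1) - u n) ^ 2) = d ∧ v = u 0 ^ 2} =
    sSup {v : ℝ | ∃ u : ℤ → ℝ, Summable (fun n => u n ^ 2) ∧
        (∑' n : ℤ, u n ^ 2) = 1 ∧ (∑' n : ℤ, (u (n + 1) - u n) ^ 2) = 4 - d ∧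
        v = u 0 ^ 2} := by
  congr 1
  ext v
  refine ⟨exists_alternate, fun h => ?_⟩
  simpa only [Set.mem_ofPred_eq, sub_sub_cancel] using exists_alternate h
end

section
/- For every λ > 0 and every n ∈ ℤ, (1/π)·∫₀^π cos(nx)/(λ + 4 sin²(x/2)) dx = (1/√(λ(λ+4)))·((λ + 2 − √(λ(λ+4)))/2)^{|n|}. In particular this quantity is strictly positive for all n. -/
open Real

lemma continuous_cos_mul_div_green_symbol {lam : ℝ} (hlam : 0 < lam) (a : ℝ) :
    Continuous fun x : ℝ => cos (a * x) / (lam + 4 * sin (x / 2) ^ 2) :=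
  Continuous.div (by fun_prop) (by fun_prop) fun x => by positivity

/-- The cosine coefficients of the Green symbol, up to the factor `1 / π`. -/
noncomputable def greenCoeff (lam : ℝ) (k : ℕ) : ℝ :=
  ∫ x in (0 : ℝ)..π, cos ((k : ℝ) * x) / (lam + 4 * sin (x / 2) ^ 2)

lemma abs_greenCoeff_le {lam : ℝ} (hlam : 0 < lam) (k : ℕ) :
    |greenCoeff lam k| ≤ 1 / lam * π := by
  have h := intervalIntegral.norm_integral_le_of_norm_le_const (a := 0) (b := π) (C := 1 / lam)
    (f := fun x : ℝ => cos ((k : ℝ) * x) / (lam + 4 * sin (x / 2) ^ 2)) fun x _ => by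
      rw [norm_div, norm_of_nonneg (r := lam + 4 * sin (x / 2) ^ 2) (by positivity)]
      exact div_le_div₀ zero_le_one (abs_cos_le_one _) hlam
        (le_add_of_nonneg_right (by positivity))
  rwa [sub_zero, abs_of_pos pi_pos] at h

/-- `cos ((a + 1) x) + cos ((a - 1) x) = 2 cos x cos (a x)` in integrated form. -/
lemma integral_cos_div_green_symbol_add {lam : ℝ} (hlam : 0 < lam) (a : ℝ) :
    (∫ x in (0 : ℝ)..π, cos ((a + 1) * x) / (lam + 4 * sin (x / 2) ^ 2)) +
        ∫ x in (0 : ℝ)..π, cos ((a - 1) * x) / (lam + 4 * sin (x / 2) ^ 2) =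
      (lam + 2) * (∫ x in (0 : ℝ)..π, cos (a * x) / (lam + 4 * sin (x / 2) ^ 2)) -
        ∫ x in (0 : ℝ)..π, cos (a * x) := by
  have hint (b : ℝ) := (continuous_cos_mul_div_green_symbol hlam b).intervalIntegrable
    (μ := MeasureTheory.volume) 0 π
  rw [← intervalIntegral.integral_add (hint _) (hint _), ← intervalIntegral.integral_const_mul,
    ← intervalIntegral.integral_sub ((hint a).const_mul _)
      (Continuous.intervalIntegrable (by fun_prop) _ _)]
  refine intervalIntegral.integral_congr fun x _ => ?_
  have hD : lam + 4 * sin (x / 2) ^ 2 ≠ 0 := by positivity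
  have hx : cos x = (lam + 2 - (lam + 4 * sin (x / 2) ^ 2)) / 2 := by
    rw [sin_sq_eq_half_sub, mul_div_cancel₀ x two_ne_zero]
    ring
  generalize lam + 4 * sin (x / 2) ^ 2 = D at hD hx
  simp only [add_mul, sub_mul, one_mul, cos_add, cos_sub, hx]
  field_simp
  ring

lemma greenCoeff_add_two {lam : ℝ} (hlam : 0 < lam) (k : ℕ) :
    greenCoeff lam (k + 2) + greenCoeff lam k = (lam + 2) * greenCoeff lam (k + 1) := by
  have h := integral_cos_div_green_symbol_add hlam ((k : ℝ) + 1)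
  have h0 : ∫ x in (0 : ℝ)..π, cos (((k : ℝ) + 1) * x) = 0 := by
    have hk : ((k : ℝ) + 1) ≠ 0 := by positivity
    have hs : sin (((k : ℝ) + 1) * π) = 0 := by exact_mod_cast sin_nat_mul_pi (k + 1)
    rw [intervalIntegral.integral_comp_mul_left (fun x => cos x) hk, integral_cos]
    simp [hs]
  rw [h0, sub_zero, add_sub_cancel_right, add_assoc, one_add_one_eq_two] at h
  simpa [greenCoeff] using h

lemma greenCoeff_one {lam : ℝ} (hlam : 0 < lam) :
    2 * greenCoeff lam 1 = (lam + 2) * greenCoeff lam 0 - π := by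
  have h := integral_cos_div_green_symbol_add hlam 0
  simp only [zero_add, zero_sub, neg_mul, cos_neg, zero_mul, cos_zero] at h
  rw [← two_mul] at h
  simpa [greenCoeff] using h

/-- A bounded solution of the recurrence is a multiple of the decaying one. -/
lemma greenCoeff_succ {lam q : ℝ} (hlam : 0 < lam) (hq0 : 0 < q) (hq1 : q < 1)
    (hq : q ^ 2 + 1 = (lam + 2) * q) (k : ℕ) :
    greenCoeff lam (k + 1) = q * greenCoeff lam k := by
  set J : ℕ → ℝ := fun j => greenCoeff lam (j + 1) - q * greenCoeff lam j with hJ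
  have hrec (j : ℕ) : J j = q * J (j + 1) := by
    simp only [hJ]
    linear_combination -q * greenCoeff_add_two hlam j + greenCoeff lam (j + 1) * hq
  have hpow (m : ℕ) : J k = q ^ m * J (k + m) := by
    induction m with
    | zero => simp
    | succ m ih => rw [ih, hrec (k + m), pow_succ, mul_assoc, add_assoc]
  have hbound (j : ℕ) : |J j| ≤ 2 * (1 / lam * π) := by
    have h1 := abs_greenCoeff_le hlam (j + 1)
    have h2 : |q * greenCoeff lam j| ≤ 1 / lam * π := by
      rw [abs_mul, abs_of_pos hq0]
      exact (mul_le_of_le_one_left (abs_nonneg _) hq1.le).trans (abs_greenCoeff_le hlam j)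
    linarith [abs_sub (greenCoeff lam (j + 1)) (q * greenCoeff lam j)]
  have hlim : Filter.Tendsto (fun m : ℕ => q ^ m * (2 * (1 / lam * π))) Filter.atTop (nhds 0) := by
    simpa using (tendsto_pow_atTop_nhds_zero_of_lt_one hq0.le hq1).mul_const (2 * (1 / lam * π))
  have hle : |J k| ≤ 0 := ge_of_tendsto' hlim fun m => by
    rw [hpow m, abs_mul, abs_of_pos (pow_pos hq0 m)]
    exact mul_le_mul_of_nonneg_left (hbound _) (pow_pos hq0 m).le
  exact sub_eq_zero.mp (abs_nonpos_iff.mp hle)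

lemma greenCoeff_eq {lam q : ℝ} (hlam : 0 < lam) (hq0 : 0 < q) (hq1 : q < 1)
    (hq : q ^ 2 + 1 = (lam + 2) * q) (k : ℕ) :
    (lam + 2 - 2 * q) * greenCoeff lam k = π * q ^ k := by
  induction k with
  | zero =>
    linear_combination 2 * greenCoeff_succ hlam hq0 hq1 hq 0 - greenCoeff_one hlam
  | succ k ih =>
    rw [greenCoeff_succ hlam hq0 hq1 hq, pow_succ]
    linear_combination q * ih

/-- Explicit formula for the 1D Green's function: for `λ > 0` and `n ∈ ℤ`,
`(1/π) ∫₀^π cos(nx)/(λ + 4 sin²(x/2)) dx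
  = (1/√(λ(λ+4))) ((λ+2-√(λ(λ+4)))/2)^{|n|} > 0`. -/
theorem green_function_formula_1D (lam : ℝ) (hlam : 0 < lam) (n : ℤ) :
    (1 / π) * (∫ x in (0 : ℝ)..π, Real.cos ((n : ℝ) * x) / (lam + 4 * Real.sin (x / 2) ^ 2)) =
      (1 / Real.sqrt (lam * (lam + 4))) *
        ((lam + 2 - Real.sqrt (lam * (lam + 4))) / 2) ^ n.natAbs ∧
    0 < (1 / π) *
        (∫ x in (0 : ℝ)..π, Real.cos ((n : ℝ) * x) / (lam + 4 * Real.sin (x / 2) ^ 2)) := by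
  have hn : (∫ x in (0 : ℝ)..π, cos ((n : ℝ) * x) / (lam + 4 * sin (x / 2) ^ 2)) =
      greenCoeff lam n.natAbs := by
    refine intervalIntegral.integral_congr fun x _ => ?_
    rcases Int.natAbs_eq n with h | h <;> rw [h] <;> simp
  have hs : 0 < √(lam * (lam + 4)) := sqrt_pos.mpr (by positivity)
  have hs2 : √(lam * (lam + 4)) ^ 2 = lam * (lam + 4) := sq_sqrt (by positivity)
  rw [hn]
  set s := √(lam * (lam + 4))
  have hq0 : 0 < (lam + 2 - s) / 2 := by nlinarith
  have hq1 : (lam + 2 - s) / 2 < 1 := by nlinarith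
  have hq := greenCoeff_eq hlam hq0 hq1 (by linear_combination hs2 / 4) n.natAbs
  have hform : 1 / π * greenCoeff lam n.natAbs = 1 / s * ((lam + 2 - s) / 2) ^ n.natAbs := by
    rw [one_div_mul_eq_div, one_div_mul_eq_div, div_eq_div_iff pi_ne_zero hs.ne']
    linear_combination hq
  exact ⟨hform, hform ▸ by positivity⟩
end

section
/- For λ > 0 define the sequence G_λ(n) := (1/√(λ(λ+4)))·((λ + 2 − √(λ(λ+4)))/2)^{|n|} for n ∈ ℤ. Then ∑_{n∈ℤ} G_λ(n)² = (λ+2)/((λ+4)·√(λ³(λ+4))) and ∑_{n∈ℤ} (G_λ(n+1) − G_λ(n))² = 2/√(λ(λ+4)³). -/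
open Real

/-- An even geometric sequence on `ℤ` has square sum `a² (1 + q²) / (1 - q²)`. -/
lemma hasSum_sq_mul_pow_natAbs (a : ℝ) {q : ℝ} (hq : q ^ 2 < 1) :
    HasSum (fun n : ℤ => (a * q ^ n.natAbs) ^ 2) (a ^ 2 * (1 + q ^ 2) / (1 - q ^ 2)) := by
  have hgeo := hasSum_geometric_of_lt_one (sq_nonneg q) hq
  have hpos : HasSum (fun n : ℕ => (a * q ^ (n : ℤ).natAbs) ^ 2) (a ^ 2 * (1 - q ^ 2)⁻¹) := by
    refine (hgeo.mul_left (a ^ 2)).congr_fun fun n => ?_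
    rw [Int.natAbs_natCast]
    ring
  have hneg : HasSum (fun n : ℕ => (a * q ^ (-((n : ℤ) + 1)).natAbs) ^ 2)
      (a ^ 2 * q ^ 2 * (1 - q ^ 2)⁻¹) := by
    refine (hgeo.mul_left (a ^ 2 * q ^ 2)).congr_fun fun n => ?_
    rw [show (-((n : ℤ) + 1)).natAbs = n + 1 by omega]
    ring
  convert HasSum.of_nat_of_neg_add_one (f := fun n : ℤ => (a * q ^ n.natAbs) ^ 2) hpos hneg using 1
  ring

/-- The increments of an even geometric sequence on `ℤ` have square sum
`2 a² (1 - q)² / (1 - q²)`. -/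
lemma hasSum_sq_sub_mul_pow_natAbs (a : ℝ) {q : ℝ} (hq : q ^ 2 < 1) :
    HasSum (fun n : ℤ => (a * q ^ (n + 1).natAbs - a * q ^ n.natAbs) ^ 2)
      (2 * a ^ 2 * (1 - q) ^ 2 / (1 - q ^ 2)) := by
  have hgeo := (hasSum_geometric_of_lt_one (sq_nonneg q) hq).mul_left (a ^ 2 * (1 - q) ^ 2)
  have hpos : HasSum
      (fun n : ℕ => (a * q ^ ((n : ℤ) + 1).natAbs - a * q ^ (n : ℤ).natAbs) ^ 2)
      (a ^ 2 * (1 - q) ^ 2 * (1 - q ^ 2)⁻¹) := by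
    refine hgeo.congr_fun fun n => ?_
    rw [Int.natAbs_natCast, show ((n : ℤ) + 1).natAbs = n + 1 by omega]
    ring
  have hneg : HasSum
      (fun n : ℕ => (a * q ^ (-((n : ℤ) + 1) + 1).natAbs - a * q ^ (-((n : ℤ) + 1)).natAbs) ^ 2)
      (a ^ 2 * (1 - q) ^ 2 * (1 - q ^ 2)⁻¹) := by
    refine hgeo.congr_fun fun n => ?_
    rw [show (-((n : ℤ) + 1) + 1).natAbs = n by omega,
      show (-((n : ℤ) + 1)).natAbs = n + 1 by omega]
    ring
  convert HasSum.of_nat_of_neg_add_one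
    (f := fun n : ℤ => (a * q ^ (n + 1).natAbs - a * q ^ n.natAbs) ^ 2) hpos hneg using 1
  ring

/-- Norms of the 1D Green's function `G_λ(n) = (1/√(λ(λ+4))) q₁(λ)^{|n|}`:
`∑ G_λ(n)² = (λ+2)/((λ+4)√(λ³(λ+4)))` and `∑ (G_λ(n+1)-G_λ(n))² = 2/√(λ(λ+4)³)`. -/
theorem green_function_norms_1D (lam : ℝ) (hlam : 0 < lam) (G : ℤ → ℝ)
    (hG : ∀ n : ℤ, G n = (1 / Real.sqrt (lam * (lam + 4))) *
        ((lam + 2 - Real.sqrt (lam * (lam + 4))) / 2) ^ n.natAbs) :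
    (∑' n : ℤ, G n ^ 2) = (lam + 2) / ((lam + 4) * Real.sqrt (lam ^ 3 * (lam + 4))) ∧
    (∑' n : ℤ, (G (n + 1) - G n) ^ 2) = 2 / Real.sqrt (lam * (lam + 4) ^ 3) := by
  set s := √(lam * (lam + 4))
  set q := (lam + 2 - s) / 2 with hqdef
  have hs0 : 0 < s := Real.sqrt_pos.2 (by positivity)
  have hs2 : s ^ 2 = lam * (lam + 4) := Real.sq_sqrt (by positivity)
  have hslt : s < lam + 2 := by nlinarith
  have hq0 : 0 < q := by rw [hqdef]; linarith
  have hsub : 1 - q ^ 2 = s * q := by rw [hqdef]; linear_combination hs2 / 4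
  have hadd : 1 + q ^ 2 = (lam + 2) * q := by rw [hqdef]; linear_combination hs2 / 4
  have hsqsub : (1 - q) ^ 2 = lam * q := by linear_combination hadd
  have hq1 : q ^ 2 < 1 := by linarith [mul_pos hs0 hq0]
  have hsqrt₁ : √(lam ^ 3 * (lam + 4)) = lam * s := by
    rw [show lam ^ 3 * (lam + 4) = lam ^ 2 * (lam * (lam + 4)) by ring,
      Real.sqrt_mul (by positivity), Real.sqrt_sq hlam.le]
  have hsqrt₂ : √(lam * (lam + 4) ^ 3) = (lam + 4) * s := by
    rw [show lam * (lam + 4) ^ 3 = (lam + 4) ^ 2 * (lam * (lam + 4)) by ring,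
      Real.sqrt_mul (by positivity), Real.sqrt_sq (by positivity)]
  have ha : (1 / s) ^ 2 = 1 / (lam * (lam + 4)) := by rw [div_pow, hs2, one_pow]
  simp only [hG]
  constructor
  · rw [(hasSum_sq_mul_pow_natAbs (1 / s) hq1).tsum_eq, hadd, hsub, hsqrt₁, ha]
    field_simp
  · rw [(hasSum_sq_sub_mul_pow_natAbs (1 / s) hq1).tsum_eq, hsqsub, hsub, hsqrt₂, ha]
    field_simp
end

section
/- For every λ > 0, (1/(4π²))·∫₀^{2π}∫₀^{2π} dx dy / (λ + 4(sin²(x/2) + sin²(y/2))) = (2/π)·K(4/(4+λ))/(4+λ), where K is the complete elliptic integral of the first kind. -/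
open Real

/-- The complete elliptic integral of the first kind. -/
noncomputable def ellipticK (k : ℝ) : ℝ :=
  ∫ t in (0 : ℝ)..1, 1 / Real.sqrt ((1 - t ^ 2) * (1 - k ^ 2 * t ^ 2))

open MeasureTheory Set Function

/-- The elementary integral of `1 / (A - B cos x)` over a period. -/
theorem integral_one_div_sub_mul_cos {A B : ℝ} (h : |B| < A) :
    ∫ x in (0 : ℝ)..(2 * π), 1 / (A - B * cos x) = 2 * π / √(A ^ 2 - B ^ 2) := by
  obtain ⟨hB1, hB2⟩ := abs_lt.mp h
  have hs2 : √(A ^ 2 - B ^ 2) ^ 2 = A ^ 2 - B ^ 2 := sq_sqrt (by nlinarith)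
  have hs : 0 < √(A ^ 2 - B ^ 2) := sqrt_pos.mpr (by nlinarith)
  set s := √(A ^ 2 - B ^ 2)
  have hpos (x : ℝ) : 0 < A - B * cos x := by
    have hBc : B * cos x ≤ |B| := by
      refine (le_abs_self _).trans ?_
      rw [abs_mul]
      exact mul_le_of_le_one_right (abs_nonneg B) (abs_cos_le_one x)
    linarith
  have hD (x : ℝ) : 0 < A + s - B * cos x := by linarith [hpos x]
  have hderiv (x : ℝ) :
      HasDerivAt (fun x => (x + 2 * arctan (B * sin x / (A + s - B * cos x))) / s)
        (1 / (A - B * cos x)) x := by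
    have hg := ((hasDerivAt_sin x).const_mul B).div
      (((hasDerivAt_cos x).const_mul B).const_sub (A + s)) (hD x).ne'
    refine (((hasDerivAt_id x).add (hg.arctan.const_mul 2)).div_const s).congr_deriv ?_
    have hpx := (hpos x).ne'
    have hDx := (hD x).ne'
    have hsc := sin_sq_add_cos_sq x
    have hA : A + s ≠ 0 := by linarith
    have hq : (A + s - B * cos x) ^ 2 + (B * sin x) ^ 2 =
        2 * (A + s) * (A - B * cos x) := by
      linear_combination B ^ 2 * hsc + hs2
    have hq' : 1 + (B * sin x / (A + s - B * cos x)) ^ 2 =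
        2 * (A + s) * (A - B * cos x) / (A + s - B * cos x) ^ 2 := by
      rw [← hq]; field_simp
    rw [Pi.div_apply, hq']
    field_simp
    linear_combination -B ^ 2 * hsc - hs2
  rw [intervalIntegral.integral_eq_sub_of_hasDerivAt (fun x _ => hderiv x)]
  · simp
  · exact (Continuous.div continuous_const (by fun_prop)
      fun x => (hpos x).ne').intervalIntegrable _ _

/-- The trigonometric form of the complete elliptic integral of the first kind. -/
theorem ellipticK_eq_integral_sin (k : ℝ) :
    ellipticK k = ∫ θ in (0 : ℝ)..(π / 2), 1 / √(1 - k ^ 2 * sin θ ^ 2) := by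
  have himage : sin '' Ioo 0 (π / 2) = Ioo 0 1 := by
    ext t
    constructor
    · rintro ⟨x, ⟨h0, h1⟩, rfl⟩
      refine ⟨sin_pos_of_pos_of_lt_pi h0 (by linarith [pi_pos]), ?_⟩
      rw [← sin_pi_div_two]
      exact sin_lt_sin_of_lt_of_le_pi_div_two (by linarith) le_rfl h1
    · rintro ⟨h0, h1⟩
      exact ⟨arcsin t, ⟨arcsin_pos.mpr h0, arcsin_lt_pi_div_two.mpr h1⟩,
        sin_arcsin (by linarith) h1.le⟩
  have hinj : InjOn sin (Ioo 0 (π / 2)) := injOn_sin.mono <|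
    Ioo_subset_Icc_self.trans (Icc_subset_Icc_left (by linarith [pi_pos]))
  rw [ellipticK, intervalIntegral.integral_of_le zero_le_one,
    intervalIntegral.integral_of_le (by positivity), integral_Ioc_eq_integral_Ioo,
    integral_Ioc_eq_integral_Ioo, ← himage,
    integral_image_eq_integral_abs_deriv_smul measurableSet_Ioo
      (fun x _ => (hasDerivAt_sin x).hasDerivWithinAt) hinj]
  refine setIntegral_congr_fun measurableSet_Ioo fun x hx => ?_
  have hc : 0 < cos x := cos_pos_of_mem_Ioo ⟨by linarith [hx.1, pi_pos], hx.2⟩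
  have hsq : 1 - sin x ^ 2 = cos x ^ 2 := by linarith [sin_sq_add_cos_sq x]
  simp only [smul_eq_mul]
  rw [hsq, sqrt_mul (sq_nonneg _), sqrt_sq hc.le, abs_of_pos hc, one_div, mul_inv,
    mul_inv_cancel_left₀ hc.ne', one_div]

/-- The integral of `1 / √(1 - k² cos²(y/2))` over `[0, 2π]` consists of four quarter periods. -/
theorem integral_cos_half_eq_four_mul_ellipticK {k : ℝ} (hk : |k| < 1) :
    ∫ y in (0 : ℝ)..(2 * π), 1 / √(1 - k ^ 2 * cos (y / 2) ^ 2) = 4 * ellipticK k := by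
  have hk2 : k ^ 2 < 1 := (sq_lt_one_iff_abs_lt_one k).mpr hk
  have hcont : Continuous fun v => 1 / √(1 - k ^ 2 * cos v ^ 2) := by
    refine Continuous.div continuous_const (by fun_prop) fun v => (sqrt_pos.mpr ?_).ne'
    nlinarith [cos_sq_le_one v, sq_nonneg k, sq_nonneg (cos v)]
  have h1 : ∫ v in (0 : ℝ)..(π / 2), 1 / √(1 - k ^ 2 * cos v ^ 2) = ellipticK k := by
    have := intervalIntegral.integral_comp_sub_left (a := 0) (b := π / 2)
      (fun v => 1 / √(1 - k ^ 2 * cos v ^ 2)) (π / 2)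
    simp only [cos_pi_div_two_sub, sub_self, sub_zero] at this
    rw [← this, ellipticK_eq_integral_sin]
  have h2 : ∫ v in (π / 2)..π, 1 / √(1 - k ^ 2 * cos v ^ 2) = ellipticK k := by
    have := intervalIntegral.integral_comp_add_right (a := 0) (b := π / 2)
      (fun v => 1 / √(1 - k ^ 2 * cos v ^ 2)) (π / 2)
    simp only [cos_add_pi_div_two, neg_sq, zero_add, add_halves] at this
    rw [← this, ellipticK_eq_integral_sin]
  rw [intervalIntegral.integral_comp_div (fun v => 1 / √(1 - k ^ 2 * cos v ^ 2)) two_ne_zero,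
    zero_div, mul_div_cancel_left₀ π two_ne_zero,
    ← intervalIntegral.integral_add_adjacent_intervals (hcont.intervalIntegrable 0 (π / 2))
      (hcont.intervalIntegrable (π / 2) π), h1, h2, smul_eq_mul]
  ring

/-- For `λ > 0`,
`(1/(4π²)) ∫₀^{2π}∫₀^{2π} dxdy/(λ + 4(sin²(x/2)+sin²(y/2)))
  = (2/π) K(4/(4+λ))/(4+λ)`. -/
theorem green_function_2D_at_origin (lam : ℝ) (hlam : 0 < lam) :
    (1 / (4 * π ^ 2)) *
        (∫ x in (0 : ℝ)..(2 * π), ∫ y in (0 : ℝ)..(2 * π),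
          1 / (lam + 4 * (Real.sin (x / 2) ^ 2 + Real.sin (y / 2) ^ 2))) =
      (2 / π) * ellipticK (4 / (4 + lam)) / (4 + lam) := by
  have hM : 0 < 4 + lam := by linarith
  have hsin (x : ℝ) : 2 * sin (x / 2) ^ 2 = 1 - cos x := by
    have := cos_two_mul' (x / 2)
    rw [mul_div_cancel₀ x two_ne_zero] at this
    linarith [sin_sq_add_cos_sq (x / 2)]
  have hden (x y : ℝ) : lam + 4 * (sin (x / 2) ^ 2 + sin ((x + y) / 2) ^ 2) =
      4 + lam - 4 * cos (y / 2) * cos (x + y / 2) := by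
    have h := cos_add_cos x (x + y)
    rw [show (x + (x + y)) / 2 = x + y / 2 by ring,
      show (x - (x + y)) / 2 = -(y / 2) by ring, cos_neg] at h
    linear_combination 2 * hsin x + 2 * hsin (x + y) - 2 * h
  have hshear (x : ℝ) :
      ∫ y in (0 : ℝ)..(2 * π), 1 / (lam + 4 * (sin (x / 2) ^ 2 + sin (y / 2) ^ 2))
      = ∫ y in (0 : ℝ)..(2 * π), 1 / (4 + lam - 4 * cos (y / 2) * cos (x + y / 2)) := by
    have hper : Periodic (fun y => 1 / (lam + 4 * (sin (x / 2) ^ 2 + sin (y / 2) ^ 2)))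
        (2 * π) := fun y => by
      beta_reduce
      rw [add_div, mul_div_cancel_left₀ π two_ne_zero, sin_add_pi, neg_sq]
    have h := hper.intervalIntegral_add_eq 0 x
    rw [zero_add] at h
    simp_rw [← hden, h]
    rw [intervalIntegral.integral_comp_add_left
      (fun y => 1 / (lam + 4 * (sin (x / 2) ^ 2 + sin (y / 2) ^ 2))), add_zero]
  have hcont : Continuous
      (uncurry fun x y : ℝ => 1 / (4 + lam - 4 * cos (y / 2) * cos (x + y / 2))) := by
    refine Continuous.div continuous_const (by fun_prop) fun p => ?_
    rw [← hden]
    positivity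
  have hk : 4 / (4 + lam) < 1 := (div_lt_one hM).mpr (by linarith)
  have hinner (y : ℝ) :
      ∫ x in (0 : ℝ)..(2 * π), 1 / (4 + lam - 4 * cos (y / 2) * cos (x + y / 2))
      = 2 * π / (4 + lam) * (1 / √(1 - (4 / (4 + lam)) ^ 2 * cos (y / 2) ^ 2)) := by
    have hper : Periodic (fun x => 1 / (4 + lam - 4 * cos (y / 2) * cos x)) (2 * π) := fun x => by
      beta_reduce
      rw [cos_add_two_pi]
    have h := hper.intervalIntegral_add_eq (y / 2) 0
    rw [intervalIntegral.integral_comp_add_right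
      (fun x => 1 / (4 + lam - 4 * cos (y / 2) * cos x)), zero_add, add_comm (2 * π), h, zero_add,
      integral_one_div_sub_mul_cos]
    · rw [show (4 + lam) ^ 2 - (4 * cos (y / 2)) ^ 2 =
          (4 + lam) ^ 2 * (1 - (4 / (4 + lam)) ^ 2 * cos (y / 2) ^ 2) by field_simp,
        sqrt_mul (sq_nonneg _), sqrt_sq hM.le, div_mul_div_comm, mul_one]
    · rw [abs_mul, abs_of_pos four_pos]
      linarith [abs_cos_le_one (y / 2)]
  simp_rw [hshear]
  rw [intervalIntegral_intervalIntegral_swap]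
  · simp_rw [hinner]
    rw [intervalIntegral.integral_const_mul,
      integral_cos_half_eq_four_mul_ellipticK (by rwa [abs_of_pos (by positivity)])]
    field_simp
  · exact (hcont.continuousOn.integrableOn_compact (isCompact_uIcc.prod isCompact_uIcc)).mono_set
      (prod_mono uIoc_subset_uIcc uIoc_subset_uIcc)
end

section
/- Let θ ∈ (0,1) and set K₂(θ) := (2/π)·(1/(θ^θ·(1−θ)^{1−θ}))·sup_{λ>0} [ λ^θ·K(4/(4+λ))/(4+λ) ], where K is the complete elliptic integral of the first kind. Then K₂(θ) is finite, the supremum is attained, and for every u ∈ l²(ℤ²) one has u(0,0)² ≤ K₂(θ)·‖u‖^{2θ}·‖∇u‖^{2(1−θ)}. Moreover K₂(θ) is the least constant for which this inequality holds for all u ∈ l²(ℤ²). -/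
open Real

/-- The number of simple-random-walk paths on `ℤ` of length `n` from `0` to `j`. -/
def lineWalks : ℕ → ℤ → ℕ
  | 0, j => if j = 0 then 1 else 0
  | n + 1, j => lineWalks n (j - 1) + lineWalks n (j + 1)

/-- The number of nearest-neighbour paths on `ℤ²` of length `n` from the origin to `(x, y)`,
computed in the rotated coordinates `x + y` and `x - y`. -/
def planeWalks (n : ℕ) (p : ℤ × ℤ) : ℕ :=
  lineWalks n (p.1 + p.2) * lineWalks n (p.1 - p.2)

lemma lineWalks_eq_zero_of_lt (n : ℕ) (j : ℤ) (h : n < j) : lineWalks n j = 0 := by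
  induction n generalizing j with
  | zero => simp [lineWalks]; omega
  | succ n ih =>
    push_cast at h
    simp [lineWalks, ih (j - 1) (by omega), ih (j + 1) (by omega)]

lemma lineWalks_sub_two_mul (n k : ℕ) : lineWalks n (n - 2 * k) = n.choose k := by
  induction n generalizing k with
  | zero =>
    cases k with
    | zero => simp [lineWalks]
    | succ k => simp [lineWalks]; omega
  | succ n ih =>
    rw [lineWalks, show ((n + 1 : ℕ) : ℤ) - 2 * k - 1 = n - 2 * k by push_cast; ring, ih]
    cases k with
    | zero => simp [lineWalks_eq_zero_of_lt n _ (show (n : ℤ) < (n : ℤ) + 1 + 1 by omega)]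
    | succ k =>
      rw [show ((n + 1 : ℕ) : ℤ) - 2 * (k + 1 : ℕ) + 1 = n - 2 * k by push_cast; ring, ih,
        Nat.choose_succ_succ, add_comm]

lemma lineWalks_eq_zero_of_odd (n : ℕ) (j : ℤ) (h : Odd (n + j)) : lineWalks n j = 0 := by
  induction n generalizing j with
  | zero =>
    obtain ⟨k, hk⟩ := h
    simp [lineWalks]; push_cast at hk; omega
  | succ n ih =>
    obtain ⟨k, hk⟩ := h
    push_cast at hk
    simp [lineWalks, ih (j - 1) ⟨k - 1, by omega⟩, ih (j + 1) ⟨k, by omega⟩]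

lemma planeWalks_even_origin (m : ℕ) : planeWalks (2 * m) (0, 0) = m.centralBinom ^ 2 := by
  have := lineWalks_sub_two_mul (2 * m) m
  rw [show ((2 * m : ℕ) : ℤ) - 2 * m = 0 by push_cast; ring] at this
  simp [planeWalks, this, Nat.centralBinom, sq]

lemma planeWalks_odd_origin (m : ℕ) : planeWalks (2 * m + 1) (0, 0) = 0 := by
  have := lineWalks_eq_zero_of_odd (2 * m + 1) 0 ⟨m, by push_cast; ring⟩
  simp [planeWalks, this]

lemma planeWalks_zero (p : ℤ × ℤ) : planeWalks 0 p = if p = (0, 0) then 1 else 0 := by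
  obtain ⟨x, y⟩ := p
  simp only [planeWalks, lineWalks, Prod.mk.injEq]
  split_ifs <;> first | rfl | omega

lemma planeWalks_succ (n : ℕ) (p : ℤ × ℤ) :
    planeWalks (n + 1) p = planeWalks n (p + (1, 0)) + planeWalks n (p - (1, 0)) +
      planeWalks n (p + (0, 1)) + planeWalks n (p - (0, 1)) := by
  obtain ⟨x, y⟩ := p
  simp only [planeWalks, lineWalks, Prod.mk_add_mk, Prod.mk_sub_mk, add_zero, sub_zero]
  ring_nf

lemma HasSum.comp_add_right {f : ℤ × ℤ → ℝ} {s : ℝ} (hf : HasSum f s) (e : ℤ × ℤ) :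
    HasSum (fun p => f (p + e)) s :=
  (Equiv.hasSum_iff (f := f) (Equiv.addRight e)).mpr hf

lemma HasSum.comp_sub_right {f : ℤ × ℤ → ℝ} {s : ℝ} (hf : HasSum f s) (e : ℤ × ℤ) :
    HasSum (fun p => f (p - e)) s :=
  (Equiv.hasSum_iff (f := f) (Equiv.subRight e)).mpr hf

lemma hasSum_planeWalks (n : ℕ) : HasSum (fun p => (planeWalks n p : ℝ)) (4 ^ n) := by
  induction n with
  | zero =>
    simpa [planeWalks_zero] using hasSum_ite_eq ((0, 0) : ℤ × ℤ) (1 : ℝ)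
  | succ n ih =>
    convert! (((ih.comp_add_right (1, 0)).add (ih.comp_sub_right (1, 0))).add
      (ih.comp_add_right (0, 1))).add (ih.comp_sub_right (0, 1)) using 1
    · ext p
      rw [planeWalks_succ]
      push_cast
      rfl
    · ring

/-- The Green's function of `-Δ + (a - 4)` on `ℤ²`. -/
noncomputable def latticeGreen (a : ℝ) (p : ℤ × ℤ) : ℝ :=
  ∑' n : ℕ, planeWalks n p / a ^ (n + 1)

section Green

variable {a : ℝ}

lemma summable_planeWalks_prod (ha : 4 < a) :
    Summable fun q : ℕ × (ℤ × ℤ) => (planeWalks q.1 q.2 : ℝ) / a ^ (q.1 + 1) := by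
  have ha0 : 0 < a := by linarith
  rw [summable_prod_of_nonneg fun q => by positivity]
  refine ⟨fun n => (hasSum_planeWalks n).summable.div_const (a ^ (n + 1)), ?_⟩
  have h (n : ℕ) : ∑' p, (planeWalks n p : ℝ) / a ^ (n + 1) = a⁻¹ * (4 / a) ^ n := by
    rw [tsum_div_const, (hasSum_planeWalks n).tsum_eq, div_pow, pow_succ]
    field_simp
  simp only [h]
  exact (summable_geometric_of_lt_one (by positivity) ((div_lt_one ha0).mpr ha)).mul_left _

lemma summable_planeWalks (ha : 4 < a) (p : ℤ × ℤ) :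
    Summable fun n : ℕ => (planeWalks n p : ℝ) / a ^ (n + 1) :=
  Summable.comp_injective (f := fun q : ℕ × (ℤ × ℤ) => (planeWalks q.1 q.2 : ℝ) / a ^ (q.1 + 1))
    (i := fun n => (n, p)) (summable_planeWalks_prod ha) (Prod.mk_left_injective p)

lemma latticeGreen_nonneg (ha : 4 < a) (p : ℤ × ℤ) : 0 ≤ latticeGreen a p :=
  tsum_nonneg fun n => div_nonneg (Nat.cast_nonneg _) (by positivity)

lemma summable_latticeGreen (ha : 4 < a) : Summable (latticeGreen a) :=
  (summable_planeWalks_prod ha).prod_symm.prod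

lemma summable_latticeGreen_sq (ha : 4 < a) : Summable fun p => latticeGreen a p ^ 2 := by
  refine ((summable_latticeGreen ha).mul_left (∑' q, latticeGreen a q)).of_nonneg_of_le
    (fun p => sq_nonneg _) fun p => ?_
  rw [sq]
  exact mul_le_mul_of_nonneg_right
    ((summable_latticeGreen ha).le_tsum p fun q _ => latticeGreen_nonneg ha q)
    (latticeGreen_nonneg ha p)

lemma latticeGreen_equation (ha : 4 < a) (p : ℤ × ℤ) :
    a * latticeGreen a p - (latticeGreen a (p + (1, 0)) + latticeGreen a (p - (1, 0)) +
      latticeGreen a (p + (0, 1)) + latticeGreen a (p - (0, 1))) =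
      if p = (0, 0) then 1 else 0 := by
  have ha0 : 0 < a := by linarith
  have hs := summable_planeWalks ha
  have key : a * latticeGreen a p = (if p = (0, 0) then 1 else 0) +
      ∑' n : ℕ, (planeWalks (n + 1) p : ℝ) / a ^ (n + 1) := by
    rw [latticeGreen, (hs p).tsum_eq_zero_add, mul_add, ← tsum_mul_left, planeWalks_zero]
    congr 1
    · split_ifs <;> simp [ha0.ne']
    · congr 1
      ext n
      rw [pow_succ _ (n + 1)]
      field_simp
  rw [key, add_sub_assoc, add_eq_left, sub_eq_zero]
  simp only [latticeGreen]
  rw [← (hs _).tsum_add (hs _), ← ((hs _).add (hs _)).tsum_add (hs _),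
    ← (((hs _).add (hs _)).add (hs _)).tsum_add (hs _)]
  congr 1
  ext n
  rw [planeWalks_succ]
  push_cast
  ring

end Green

/-- Summation by parts for square-summable functions on `ℤ²`. -/
lemma tsum_dirichlet_form_eq {u v : ℤ × ℤ → ℝ} (hu : Summable fun p => u p ^ 2)
    (hv : Summable fun p => v p ^ 2) (lam : ℝ) :
    Summable (fun p : ℤ × ℤ => lam * (v p * u p) +
      ((v (p.1 + 1, p.2) - v p) * (u (p.1 + 1, p.2) - u p) +
       (v (p.1, p.2 + 1) - v p) * (u (p.1, p.2 + 1) - u p))) ∧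
    ∑' p : ℤ × ℤ, (lam * (v p * u p) +
      ((v (p.1 + 1, p.2) - v p) * (u (p.1 + 1, p.2) - u p) +
       (v (p.1, p.2 + 1) - v p) * (u (p.1, p.2 + 1) - u p))) =
    ∑' p : ℤ × ℤ, v p * ((4 + lam) * u p -
      (u (p + (1, 0)) + u (p - (1, 0)) + u (p + (0, 1)) + u (p - (0, 1)))) := by
  have hmul {f g : ℤ × ℤ → ℝ} (hf : Summable fun p => f p ^ 2)
      (hg : Summable fun p => g p ^ 2) : Summable fun p => f p * g p := by
    refine Summable.of_norm_bounded (hf.add hg) fun p => ?_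
    rw [Real.norm_eq_abs, abs_le]
    constructor <;> nlinarith [sq_nonneg (f p + g p), sq_nonneg (f p - g p)]
  have hadd {f : ℤ × ℤ → ℝ} (e : ℤ × ℤ) (hf : Summable fun p => f p ^ 2) :
      Summable fun p => f (p + e) ^ 2 := (hf.hasSum.comp_add_right e).summable
  have hsub {f : ℤ × ℤ → ℝ} (e : ℤ × ℤ) (hf : Summable fun p => f p ^ 2) :
      Summable fun p => f (p - e) ^ 2 := (hf.hasSum.comp_sub_right e).summable
  have h0 := (hmul hv hu).hasSum
  have hdir (e : ℤ × ℤ) : HasSum (fun p => (v (p + e) - v p) * (u (p + e) - u p))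
      ((∑' p, v p * u p) - (∑' p, v p * u (p - e)) - (∑' p, v p * u (p + e)) +
        ∑' p, v p * u p) := by
    have h1 : HasSum (fun p => v (p + e) * u (p + e)) (∑' p, v p * u p) :=
      h0.comp_add_right e
    have h2 : HasSum (fun p => v (p + e) * u p) (∑' p, v p * u (p - e)) := by
      convert! (hmul hv (hsub e hu)).hasSum.comp_add_right e using 1
      ext p
      simp
    convert! ((h1.sub h2).sub (hmul hv (hadd e hu)).hasSum).add h0 using 1
    ext p
    ring
  have hL := (h0.mul_left lam).add ((hdir (1, 0)).add (hdir (0, 1)))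
  have hR := (h0.mul_left (4 + lam)).sub
    ((((hmul hv (hadd (1, 0) hu)).hasSum.add (hmul hv (hsub (1, 0) hu)).hasSum).add
      (hmul hv (hadd (0, 1) hu)).hasSum).add (hmul hv (hsub (0, 1) hu)).hasSum)
  have hx (p : ℤ × ℤ) : (p.1 + 1, p.2) = p + (1, 0) := by ext <;> simp
  have hy (p : ℤ × ℤ) : (p.1, p.2 + 1) = p + (0, 1) := by ext <;> simp
  simp only [hx, hy]
  refine ⟨hL.summable, hL.tsum_eq.trans ?_⟩
  rw [eq_comm]
  convert! hR.tsum_eq using 1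
  · congr 1
    ext p
    ring
  · ring

/-- The Taylor coefficients of `(1 - x) ^ (-1 / 2)`. -/
noncomputable def centralRatio (m : ℕ) : ℝ := m.centralBinom / 4 ^ m

lemma centralRatio_zero : centralRatio 0 = 1 := by simp [centralRatio]

lemma centralRatio_nonneg (m : ℕ) : 0 ≤ centralRatio m := by unfold centralRatio; positivity

lemma centralRatio_succ (m : ℕ) :
    centralRatio (m + 1) = centralRatio m * ((2 * m + 1) / (2 * m + 2)) := by
  have h : ((m : ℝ) + 1) * (m + 1).centralBinom = 2 * (2 * m + 1) * m.centralBinom :=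
    mod_cast Nat.succ_mul_centralBinom_succ m
  have h2 : ((m + 1).centralBinom : ℝ) = 2 * (2 * m + 1) * m.centralBinom / (m + 1) := by
    rw [← h]; field_simp
  rw [centralRatio, centralRatio, h2, pow_succ]
  field_simp
  ring

lemma centralRatio_eq_prod (m : ℕ) :
    centralRatio m = ∏ i ∈ Finset.range m, (2 * (i : ℝ) + 1) / (2 * i + 2) := by
  induction m with
  | zero => simp [centralRatio_zero]
  | succ m ih => rw [centralRatio_succ, ih, Finset.prod_range_succ]

lemma centralRatio_sq_le (m : ℕ) : centralRatio m ^ 2 ≤ 1 / (m + 1) := by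
  induction m with
  | zero => simp [centralRatio_zero]
  | succ m ih =>
    rw [centralRatio_succ, mul_pow]
    calc centralRatio m ^ 2 * ((2 * m + 1) / (2 * m + 2)) ^ 2
        ≤ 1 / (m + 1) * ((2 * m + 1) / (2 * m + 2)) ^ 2 := by gcongr
      _ ≤ 1 / (((m + 1 : ℕ) : ℝ) + 1) := by
        push_cast
        rw [div_pow, div_mul_div_comm, div_le_div_iff₀ (by positivity) (by positivity)]
        nlinarith [Nat.cast_nonneg (α := ℝ) m]

lemma centralRatio_sq_le_one (m : ℕ) : centralRatio m ^ 2 ≤ 1 :=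
  (centralRatio_sq_le m).trans (by
    rw [div_le_one (by positivity)]
    linarith [Nat.cast_nonneg (α := ℝ) m])

lemma centralRatio_le_one (m : ℕ) : centralRatio m ≤ 1 := by
  have := centralRatio_sq_le_one m
  rwa [sq_le_one_iff₀ (centralRatio_nonneg m)] at this

lemma choose_neg_half (m : ℕ) :
    Ring.choose (-(1 / 2) : ℝ) m = (-1) ^ m * centralRatio m := by
  have h : (descPochhammer ℤ m).smeval (-(1 / 2) : ℝ) =
      m.factorial * ((-1) ^ m * centralRatio m) := by
    induction m with
    | zero => simp [centralRatio_zero]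
    | succ m ih =>
      rw [descPochhammer_succ_right, Polynomial.smeval_mul, ih, centralRatio_succ,
        Nat.factorial_succ]
      simp [Polynomial.smeval_sub, Polynomial.smeval_natCast]
      field_simp
      ring
  rw [Ring.descPochhammer_eq_factorial_smul_choose, nsmul_eq_mul] at h
  exact mul_left_cancel₀ (by positivity) h

lemma hasSum_centralRatio {x : ℝ} (hx : |x| < 1) :
    HasSum (fun m => centralRatio m * x ^ m) (1 / √(1 - x)) := by
  have h := (one_add_rpow_hasFPowerSeriesOnBall_zero (a := -(1 / 2))).hasSum (y := -x)
    (by simpa [← ofReal_norm] using hx)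
  have h1 : (1 + (0 + -x)) ^ (-(1 / 2) : ℝ) = 1 / √(1 - x) := by
    rw [zero_add, ← sub_eq_add_neg, rpow_neg (by linarith [(abs_lt.mp hx).2]), ← sqrt_eq_rpow,
      one_div]
  simp only [zero_add] at h h1
  rw [h1] at h
  convert! h using 1
  ext m
  simp only [binomialSeries_apply, choose_neg_half]
  simp
  rw [neg_pow x]
  have : ((-1 : ℝ) ^ m) * (-1) ^ m = 1 := by rw [← mul_pow]; simp
  linear_combination (-centralRatio m * x ^ m) * this

lemma integral_sin_pow_even_half (m : ℕ) :
    ∫ x in (0 : ℝ)..π / 2, sin x ^ (2 * m) = π / 2 * centralRatio m := by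
  have h := integral_sin_pow_even (n := m)
  have hint (a b : ℝ) : IntervalIntegrable (fun x => sin x ^ (2 * m)) MeasureTheory.volume a b :=
    (by fun_prop : Continuous fun x => sin x ^ (2 * m)).intervalIntegrable a b
  rw [← intervalIntegral.integral_add_adjacent_intervals (hint 0 (π / 2)) (hint (π / 2) π)] at h
  have h2 : ∫ x in (π / 2)..π, sin x ^ (2 * m) = ∫ x in (0 : ℝ)..π / 2, sin x ^ (2 * m) := by
    have := intervalIntegral.integral_comp_sub_left (a := 0) (b := π / 2)
      (fun x => sin x ^ (2 * m)) π
    simp only [sin_pi_sub] at this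
    rw [this]
    congr 1 <;> ring
  rw [h2, ← centralRatio_eq_prod] at h
  linarith

lemma ellipticK_eq_trig (k : ℝ) :
    ellipticK k = ∫ x in (0 : ℝ)..π / 2, 1 / √(1 - k ^ 2 * sin x ^ 2) := by
  have himage : sin '' Set.Ioo 0 (π / 2) = Set.Ioo 0 1 := by
    ext y
    constructor
    · rintro ⟨x, ⟨h0, h1⟩, rfl⟩
      refine ⟨sin_pos_of_pos_of_lt_pi h0 (by linarith), ?_⟩
      rw [← sin_pi_div_two]
      exact sin_lt_sin_of_lt_of_le_pi_div_two (by linarith) le_rfl h1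
    · rintro ⟨h0, h1⟩
      exact ⟨arcsin y, ⟨arcsin_pos.mpr h0, arcsin_lt_pi_div_two.mpr h1⟩,
        sin_arcsin (by linarith) h1.le⟩
  have hinj : Set.InjOn sin (Set.Ioo 0 (π / 2)) :=
    injOn_sin.mono
      (Set.Ioo_subset_Icc_self.trans (Set.Icc_subset_Icc_left (by linarith [pi_pos])))
  rw [ellipticK, intervalIntegral.integral_of_le zero_le_one,
    intervalIntegral.integral_of_le (by positivity),
    MeasureTheory.integral_Ioc_eq_integral_Ioo, MeasureTheory.integral_Ioc_eq_integral_Ioo,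
    ← himage, MeasureTheory.integral_image_eq_integral_abs_deriv_smul measurableSet_Ioo
      (fun x _ => (hasDerivAt_sin x).hasDerivWithinAt) hinj]
  refine MeasureTheory.setIntegral_congr_fun measurableSet_Ioo fun x hx => ?_
  have hcos : 0 < cos x := cos_pos_of_mem_Ioo ⟨by linarith [hx.1, pi_pos], hx.2⟩
  simp only [smul_eq_mul]
  rw [← cos_sq', sqrt_mul (sq_nonneg _), sqrt_sq hcos.le, abs_of_pos hcos, one_div, mul_inv,
    mul_inv_cancel_left₀ hcos.ne', one_div]

lemma hasSum_ellipticK {k : ℝ} (hk0 : 0 ≤ k) (hk1 : k < 1) :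
    HasSum (fun m => centralRatio m ^ 2 * (k ^ 2) ^ m) (2 / π * ellipticK k) := by
  have hk2 : k ^ 2 < 1 := by nlinarith
  have hle (x : ℝ) : k ^ 2 * sin x ^ 2 ≤ k ^ 2 :=
    mul_le_of_le_one_right (sq_nonneg k) (sin_sq_le_one x)
  have h : HasSum (fun m : ℕ => ∫ x in (0 : ℝ)..π / 2, centralRatio m * (k ^ 2 * sin x ^ 2) ^ m)
      (∫ x in (0 : ℝ)..π / 2, 1 / √(1 - k ^ 2 * sin x ^ 2)) := by
    refine intervalIntegral.hasSum_integral_of_dominated_convergence (fun m _ => (k ^ 2) ^ m)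
      (fun m => ?_) (fun m => ?_) ?_ ?_ ?_
    · exact (by fun_prop : Continuous fun x =>
        centralRatio m * (k ^ 2 * sin x ^ 2) ^ m).aestronglyMeasurable
    · refine Filter.Eventually.of_forall fun x _ => ?_
      rw [norm_of_nonneg (mul_nonneg (centralRatio_nonneg m) (by positivity))]
      calc centralRatio m * (k ^ 2 * sin x ^ 2) ^ m ≤ 1 * (k ^ 2) ^ m := by
            gcongr
            · exact centralRatio_le_one m
            · exact hle x
        _ = _ := one_mul _
    · exact Filter.Eventually.of_forall fun x _ =>
        summable_geometric_of_lt_one (sq_nonneg k) hk2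
    · exact intervalIntegrable_const
    · refine Filter.Eventually.of_forall fun x _ => hasSum_centralRatio ?_
      rw [abs_of_nonneg (by positivity)]
      exact (hle x).trans_lt hk2
  rw [ellipticK_eq_trig]
  convert! h.mul_left (2 / π) using 1
  ext m
  simp only [mul_pow, ← pow_mul, ← mul_assoc]
  rw [intervalIntegral.integral_const_mul, integral_sin_pow_even_half]
  field_simp

lemma ellipticK_nonneg {k : ℝ} (hk0 : 0 ≤ k) (hk1 : k < 1) : 0 ≤ ellipticK k := by
  have h := (hasSum_ellipticK hk0 hk1).nonneg fun m => by positivity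
  exact nonneg_of_mul_nonneg_right h (by positivity)

lemma ellipticK_le_inv {k : ℝ} (hk0 : 0 ≤ k) (hk1 : k < 1) :
    2 / π * ellipticK k ≤ (1 - k ^ 2)⁻¹ := by
  refine hasSum_le (fun m => ?_) (hasSum_ellipticK hk0 hk1)
    (hasSum_geometric_of_lt_one (sq_nonneg k) (by nlinarith))
  exact mul_le_of_le_one_left (by positivity) (centralRatio_sq_le_one m)

lemma ellipticK_mul_sq_le_log {k : ℝ} (hk0 : 0 ≤ k) (hk1 : k < 1) :
    2 / π * ellipticK k * k ^ 2 ≤ -log (1 - k ^ 2) := by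
  refine hasSum_le (fun m => ?_) ((hasSum_ellipticK hk0 hk1).mul_right (k ^ 2))
    (hasSum_pow_div_log_of_abs_lt_one
      (by rw [abs_of_nonneg (sq_nonneg k)]; nlinarith))
  calc centralRatio m ^ 2 * (k ^ 2) ^ m * k ^ 2 = centralRatio m ^ 2 * (k ^ 2) ^ (m + 1) := by ring
    _ ≤ 1 / (m + 1) * (k ^ 2) ^ (m + 1) := by
      gcongr
      exact centralRatio_sq_le m
    _ = _ := by ring

lemma continuousOn_ellipticK : ContinuousOn ellipticK (Set.Ioo 0 1) := by
  intro k₀ hk₀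
  obtain ⟨r, hr, hr1⟩ := exists_between hk₀.2
  have hr0 : 0 < r := hk₀.1.trans hr
  have hseries : ContinuousOn (fun k : ℝ => ∑' m, centralRatio m ^ 2 * (k ^ 2) ^ m)
      (Set.Icc 0 r) := by
    refine continuousOn_tsum (u := fun m => (r ^ 2) ^ m) (fun m => by fun_prop)
      (summable_geometric_of_lt_one (sq_nonneg r) (by nlinarith)) fun m k hk => ?_
    rw [norm_of_nonneg (by positivity)]
    calc centralRatio m ^ 2 * (k ^ 2) ^ m ≤ 1 * (r ^ 2) ^ m := by
          gcongr
          · exact centralRatio_sq_le_one m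
          · exact hk.1
          · exact hk.2
      _ = _ := one_mul _
  have hcont : ContinuousOn ellipticK (Set.Icc 0 r) := by
    refine (hseries.const_mul (π / 2)).congr fun k hk => ?_
    beta_reduce
    rw [(hasSum_ellipticK hk.1 (hk.2.trans_lt hr1)).tsum_eq]
    field_simp
  exact (hcont.continuousAt (Icc_mem_nhds hk₀.1 hr)).continuousWithinAt

lemma ellipticModulus_mem {lam : ℝ} (h : 0 < lam) : 4 / (4 + lam) ∈ Set.Ioo (0 : ℝ) 1 :=
  ⟨by positivity, by rw [div_lt_one (by positivity)]; linarith⟩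

lemma one_sub_ellipticModulus_sq {lam : ℝ} (h : 0 < lam) :
    1 - (4 / (4 + lam)) ^ 2 = lam * (8 + lam) / (4 + lam) ^ 2 := by
  field_simp
  ring

/-- At the origin, the lattice Green's function is a complete elliptic integral. -/
lemma latticeGreen_origin {lam : ℝ} (h : 0 < lam) :
    latticeGreen (4 + lam) (0, 0) = 2 / π * (ellipticK (4 / (4 + lam)) / (4 + lam)) := by
  obtain ⟨hk0, hk1⟩ := ellipticModulus_mem h
  have heven : HasSum (fun m : ℕ => (planeWalks (2 * m) (0, 0) : ℝ) / (4 + lam) ^ (2 * m + 1))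
      (2 / π * ellipticK (4 / (4 + lam)) * (4 + lam)⁻¹) := by
    convert! (hasSum_ellipticK hk0.le hk1).mul_right (4 + lam)⁻¹ using 1
    ext m
    rw [planeWalks_even_origin, centralRatio, ← pow_mul, div_pow, div_pow, ← pow_mul, mul_comm m 2,
      pow_succ (4 + lam)]
    push_cast
    field_simp
  have hodd : HasSum (fun m : ℕ =>
      (planeWalks (2 * m + 1) (0, 0) : ℝ) / (4 + lam) ^ (2 * m + 1 + 1)) 0 := by
    simp [planeWalks_odd_origin]
  rw [latticeGreen, (HasSum.even_add_odd
    (f := fun n : ℕ => (planeWalks n (0, 0) : ℝ) / (4 + lam) ^ (n + 1)) heven hodd).tsum_eq]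
  ring

lemma latticeGreen_origin_pos {a : ℝ} (ha : 4 < a) : 0 < latticeGreen a (0, 0) := by
  refine lt_of_lt_of_le ?_ ((summable_planeWalks ha (0, 0)).le_tsum 0 fun n _ => by positivity)
  rw [planeWalks_zero]
  simp
  linarith

lemma exists_isGreatest_ellipticK {θ : ℝ} (hθ : θ ∈ Set.Ioo (0 : ℝ) 1) :
    ∃ M : ℝ, IsGreatest {y : ℝ | ∃ lam : ℝ, 0 < lam ∧
      y = lam ^ θ * ellipticK (4 / (4 + lam)) / (4 + lam)} M := by
  obtain ⟨hθ0, hθ1⟩ := hθ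
  set F : ℝ → ℝ := fun lam => lam ^ θ * ellipticK (4 / (4 + lam)) / (4 + lam) with hF
  have hnonneg {lam : ℝ} (h : 0 < lam) : 0 ≤ F lam := by
    have := ellipticK_nonneg (ellipticModulus_mem h).1.le (ellipticModulus_mem h).2
    simp only [hF]
    positivity
  have hcont : ContinuousOn F (Set.Ioi 0) := by
    have hK : ContinuousOn (fun lam : ℝ => ellipticK (4 / (4 + lam))) (Set.Ioi 0) := by
      refine continuousOn_ellipticK.comp (fun x hx => ?_) fun x hx => ellipticModulus_mem hx
      have : 4 + x ≠ 0 := by linarith [Set.mem_Ioi.mp hx]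
      exact (by fun_prop (disch := assumption) :
        ContinuousAt (fun x : ℝ => 4 / (4 + x)) x).continuousWithinAt
    refine ((continuousOn_id.rpow_const fun x _ => Or.inr hθ0.le).mul hK).div (by fun_prop)
      fun x hx => ?_
    linarith [Set.mem_Ioi.mp hx]
  have hpos : 0 < F 1 := by
    have h := latticeGreen_origin_pos (a := 4 + 1) (by norm_num)
    rw [latticeGreen_origin one_pos] at h
    simpa [hF] using pos_of_mul_pos_right h (by positivity)
  have hinfty : Filter.Tendsto F Filter.atTop (nhds 0) := by
    have hlim : Filter.Tendsto (fun x : ℝ => π / 2 * x ^ (-(1 - θ))) Filter.atTop (nhds 0) := by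
      simpa using (tendsto_rpow_neg_atTop (by linarith : 0 < 1 - θ)).const_mul (π / 2)
    refine tendsto_of_tendsto_of_tendsto_of_le_of_le' tendsto_const_nhds hlim ?_ ?_
    · filter_upwards [Filter.eventually_gt_atTop 0] with x hx using hnonneg hx
    · filter_upwards [Filter.eventually_gt_atTop 0] with x hx
      have h := ellipticK_le_inv (ellipticModulus_mem hx).1.le (ellipticModulus_mem hx).2
      rw [one_sub_ellipticModulus_sq hx, inv_div] at h
      have h2 : ellipticK (4 / (4 + x)) ≤ π / 2 * ((4 + x) ^ 2 / (x * (8 + x))) := by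
        calc ellipticK (4 / (4 + x)) = π / 2 * (2 / π * ellipticK (4 / (4 + x))) := by field_simp
          _ ≤ _ := by gcongr
      have h3 : (4 + x) ^ 2 / (x * (8 + x)) ≤ (4 + x) / x := by
        rw [div_le_div_iff₀ (by positivity) hx]
        nlinarith [mul_pos hx hx, mul_pos (mul_pos hx hx) hx]
      calc F x ≤ x ^ θ * (π / 2 * ((4 + x) / x)) / (4 + x) := by
            simp only [hF]
            gcongr
            exact h2.trans (by gcongr)
        _ = π / 2 * (x ^ θ / x) := by field_simp
        _ = π / 2 * x ^ (-(1 - θ)) := by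
          rw [neg_sub, rpow_sub_one hx.ne']
  have hzero : Filter.Tendsto F (nhdsWithin 0 (Set.Ioi 0)) (nhds 0) := by
    have hlim : Filter.Tendsto (fun x : ℝ => π / 4 * (log 4 * x ^ θ - log x * x ^ θ))
        (nhdsWithin 0 (Set.Ioi 0)) (nhds 0) := by
      have h1 : Filter.Tendsto (fun x : ℝ => x ^ θ) (nhdsWithin 0 (Set.Ioi 0)) (nhds 0) := by
        have := (continuousAt_rpow_const 0 θ (Or.inr hθ0.le)).tendsto
        rw [zero_rpow hθ0.ne'] at this
        exact this.mono_left nhdsWithin_le_nhds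
      simpa using ((h1.const_mul (log 4)).sub (tendsto_log_mul_rpow_nhdsGT_zero hθ0)).const_mul
        (π / 4)
    refine tendsto_of_tendsto_of_tendsto_of_le_of_le' tendsto_const_nhds hlim ?_ ?_
    · filter_upwards [self_mem_nhdsWithin] with x hx using hnonneg hx
    · filter_upwards [Ioo_mem_nhdsGT (zero_lt_one' ℝ)] with x hx
      obtain ⟨hx0, hx1⟩ := hx
      have h := ellipticK_mul_sq_le_log (ellipticModulus_mem hx0).1.le (ellipticModulus_mem hx0).2
      have hK := ellipticK_nonneg (ellipticModulus_mem hx0).1.le (ellipticModulus_mem hx0).2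
      have hlog : log (x / 4) ≤ log (1 - (4 / (4 + x)) ^ 2) := by
        refine log_le_log (by positivity) ?_
        rw [one_sub_ellipticModulus_sq hx0, div_le_div_iff₀ (by norm_num) (by positivity)]
        nlinarith [mul_pos hx0 hx0, mul_pos (mul_pos hx0 hx0) hx0]
      rw [log_div hx0.ne' (by norm_num)] at hlog
      have hk : (1 / 2 : ℝ) ≤ (4 / (4 + x)) ^ 2 := by
        rw [div_pow, div_le_div_iff₀ (by norm_num) (by positivity)]
        nlinarith
      have h2 : 2 / π * ellipticK (4 / (4 + x)) * (1 / 2) ≤ log 4 - log x := by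
        refine (mul_le_mul_of_nonneg_left hk (by positivity)).trans ?_
        linarith
      have h3 : ellipticK (4 / (4 + x)) ≤ π * (log 4 - log x) := by
        calc ellipticK (4 / (4 + x)) = π * (2 / π * ellipticK (4 / (4 + x)) * (1 / 2)) := by
              field_simp
          _ ≤ _ := by gcongr
      calc F x ≤ x ^ θ * ellipticK (4 / (4 + x)) / 4 := by
            simp only [hF]
            gcongr
            linarith
        _ ≤ x ^ θ * (π * (log 4 - log x)) / 4 := by gcongr
        _ = _ := by ring
  have hcomp : Continuous fun s : ℝ => F (exp s) :=
    hcont.comp_continuous continuous_exp fun s => exp_pos s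
  obtain ⟨s, hs⟩ := hcomp.exists_forall_ge' 0 (by
    rw [cocompact_eq_atBot_atTop, Filter.eventually_sup]
    simp only [exp_zero]
    exact ⟨((hzero.comp tendsto_exp_atBot_nhdsGT).eventually_lt_const hpos).mono fun _ h => h.le,
      ((hinfty.comp tendsto_exp_atTop).eventually_lt_const hpos).mono fun _ h => h.le⟩)
  refine ⟨F (exp s), ⟨exp s, exp_pos s, rfl⟩, ?_⟩
  rintro y ⟨lam, hlam, rfl⟩
  simpa [exp_log hlam] using hs (log lam)

lemma summable_gradient_sq {u : ℤ × ℤ → ℝ} (hu : Summable fun p => u p ^ 2) :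
    Summable fun p : ℤ × ℤ =>
      (u (p.1 + 1, p.2) - u p) ^ 2 + (u (p.1, p.2 + 1) - u p) ^ 2 := by
  simpa [sq] using (tsum_dirichlet_form_eq hu hu 0).1

lemma tsum_dirichlet_form_self {u : ℤ × ℤ → ℝ} (hu : Summable fun p => u p ^ 2) (lam : ℝ) :
    ∑' p : ℤ × ℤ, (lam * (u p * u p) +
      ((u (p.1 + 1, p.2) - u p) * (u (p.1 + 1, p.2) - u p) +
       (u (p.1, p.2 + 1) - u p) * (u (p.1, p.2 + 1) - u p))) =
    lam * (∑' p : ℤ × ℤ, u p ^ 2) + ∑' p : ℤ × ℤ,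
      ((u (p.1 + 1, p.2) - u p) ^ 2 + (u (p.1, p.2 + 1) - u p) ^ 2) := by
  rw [← tsum_mul_left, ← (hu.mul_left lam).tsum_add (summable_gradient_sq hu)]
  simp only [sq]

/-- The Green's function represents evaluation at the origin in the Dirichlet form. -/
lemma tsum_dirichlet_form_latticeGreen {lam : ℝ} (h : 0 < lam) {v : ℤ × ℤ → ℝ}
    (hv : Summable fun p => v p ^ 2) :
    ∑' p : ℤ × ℤ, (lam * (v p * latticeGreen (4 + lam) p) +
      ((v (p.1 + 1, p.2) - v p) *
        (latticeGreen (4 + lam) (p.1 + 1, p.2) - latticeGreen (4 + lam) p) +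
       (v (p.1, p.2 + 1) - v p) *
        (latticeGreen (4 + lam) (p.1, p.2 + 1) - latticeGreen (4 + lam) p))) = v (0, 0) := by
  have ha : 4 < 4 + lam := by linarith
  rw [(tsum_dirichlet_form_eq (summable_latticeGreen_sq ha) hv lam).2]
  simp only [latticeGreen_equation ha, mul_ite, mul_one, mul_zero]
  exact tsum_ite_eq (0, 0) v

lemma energy_latticeGreen {lam : ℝ} (h : 0 < lam) :
    lam * (∑' p : ℤ × ℤ, latticeGreen (4 + lam) p ^ 2) + ∑' p : ℤ × ℤ,
      ((latticeGreen (4 + lam) (p.1 + 1, p.2) - latticeGreen (4 + lam) p) ^ 2 +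
        (latticeGreen (4 + lam) (p.1, p.2 + 1) - latticeGreen (4 + lam) p) ^ 2) =
      latticeGreen (4 + lam) (0, 0) := by
  have hg := summable_latticeGreen_sq (a := 4 + lam) (by linarith)
  rw [← tsum_dirichlet_form_self hg, tsum_dirichlet_form_latticeGreen h hg]

lemma sq_origin_le_latticeGreen_mul_energy {lam : ℝ} (h : 0 < lam) {v : ℤ × ℤ → ℝ}
    (hv : Summable fun p => v p ^ 2) :
    v (0, 0) ^ 2 ≤ latticeGreen (4 + lam) (0, 0) * (lam * (∑' p : ℤ × ℤ, v p ^ 2) +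
      ∑' p : ℤ × ℤ, ((v (p.1 + 1, p.2) - v p) ^ 2 + (v (p.1, p.2 + 1) - v p) ^ 2)) := by
  have hG := latticeGreen_origin_pos (a := 4 + lam) (by linarith)
  have hg := summable_latticeGreen_sq (a := 4 + lam) (by linarith)
  have hvv := (tsum_dirichlet_form_eq hv hv lam).1.hasSum
  have hvg := (tsum_dirichlet_form_eq hg hv lam).1.hasSum
  have hgg := (tsum_dirichlet_form_eq hg hg lam).1.hasSum
  rw [tsum_dirichlet_form_self hv] at hvv
  rw [tsum_dirichlet_form_latticeGreen h hv] at hvg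
  rw [tsum_dirichlet_form_latticeGreen h hg] at hgg
  set g := latticeGreen (4 + lam)
  set t := v (0, 0) / g (0, 0) with ht
  have hquad := ((hvv.sub (hvg.mul_left (2 * t))).add (hgg.mul_left (t ^ 2))).nonneg fun p => by
    have : 0 ≤ lam * (v p - t * g p) ^ 2 +
        ((v (p.1 + 1, p.2) - t * g (p.1 + 1, p.2) - (v p - t * g p)) ^ 2 +
        (v (p.1, p.2 + 1) - t * g (p.1, p.2 + 1) - (v p - t * g p)) ^ 2) := by positivity
    linarith
  have htG : t * g (0, 0) = v (0, 0) := by rw [ht]; field_simp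
  have := mul_nonneg hG.le hquad
  rw [← htG] at this ⊢
  linarith

lemma rpow_mul_rpow_le_energy {θ N D lam : ℝ} (hθ : θ ∈ Set.Ioo (0 : ℝ) 1) (hN : 0 ≤ N)
    (hD : 0 ≤ D) (h : 0 < lam) :
    N ^ θ * D ^ (1 - θ) ≤ θ ^ θ * (1 - θ) ^ (1 - θ) * (lam * N + D) / lam ^ θ := by
  obtain ⟨hθ0, hθ1⟩ := hθ
  have h1 : 0 < 1 - θ := by linarith
  have := geom_mean_le_arith_mean2_weighted hθ0.le h1.le
    (by positivity : 0 ≤ lam * N / θ) (by positivity : 0 ≤ D / (1 - θ)) (by ring)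
  rw [div_rpow (by positivity) hθ0.le, div_rpow hD h1.le, mul_rpow h.le hN,
    mul_div_cancel₀ _ hθ0.ne', mul_div_cancel₀ _ h1.ne', div_mul_div_comm,
    div_le_iff₀ (by positivity)] at this
  rw [le_div_iff₀ (by positivity)]
  linarith

lemma energy_optimal {θ N D : ℝ} (hθ : θ ∈ Set.Ioo (0 : ℝ) 1) (hN : 0 < N) (hD : 0 < D) :
    (θ * D / ((1 - θ) * N) * N + D) / (θ * D / ((1 - θ) * N)) ^ θ =
      1 / (θ ^ θ * (1 - θ) ^ (1 - θ)) * N ^ θ * D ^ (1 - θ) := by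
  obtain ⟨hθ0, hθ1⟩ := hθ
  have h1 : 0 < 1 - θ := by linarith
  rw [div_rpow (by positivity) (by positivity), mul_rpow hθ0.le hD.le, mul_rpow h1.le hN.le,
    rpow_sub hD, rpow_sub h1, rpow_one, rpow_one]
  field_simp
  ring

/-- For `θ ∈ (0,1)`, the constant
`K₂(θ) = (2/π) (1/(θ^θ (1-θ)^{1-θ})) max_{λ>0} λ^θ K(4/(4+λ))/(4+λ)`
is finite (the supremum is attained), it yields the sharp two-dimensional discrete
interpolation inequality `u(0,0)² ≤ K₂(θ) ‖u‖^{2θ} ‖∇u‖^{2(1-θ)}`, and it is the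
least constant for which this inequality holds. -/
theorem sharp_interpolation_2D (θ : ℝ) (hθ : θ ∈ Set.Ioo (0 : ℝ) 1) :
    ∃ M : ℝ,
      IsGreatest {y : ℝ | ∃ lam : ℝ, 0 < lam ∧
          y = lam ^ θ * ellipticK (4 / (4 + lam)) / (4 + lam)} M ∧
      (∀ u : ℤ × ℤ → ℝ, Summable (fun p => u p ^ 2) →
        u (0, 0) ^ 2 ≤ ((2 / π) * (1 / (θ ^ θ * (1 - θ) ^ (1 - θ))) * M) *
          (∑' p : ℤ × ℤ, u p ^ 2) ^ θ *
          (∑' p : ℤ × ℤ,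
            ((u (p.1 + 1, p.2) - u p) ^ 2 + (u (p.1, p.2 + 1) - u p) ^ 2)) ^ (1 - θ)) ∧
      (∀ C : ℝ,
        (∀ u : ℤ × ℤ → ℝ, Summable (fun p => u p ^ 2) →
          u (0, 0) ^ 2 ≤ C * (∑' p : ℤ × ℤ, u p ^ 2) ^ θ *
            (∑' p : ℤ × ℤ,
              ((u (p.1 + 1, p.2) - u p) ^ 2 + (u (p.1, p.2 + 1) - u p) ^ 2)) ^ (1 - θ)) →
        (2 / π) * (1 / (θ ^ θ * (1 - θ) ^ (1 - θ))) * M ≤ C) := by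
  obtain ⟨M, hM⟩ := exists_isGreatest_ellipticK hθ
  obtain ⟨hθ0, hθ1⟩ := id hθ
  have h1 : 0 < 1 - θ := by linarith
  obtain ⟨lam, hlam, hMeq⟩ := hM.1
  have hGM : latticeGreen (4 + lam) (0, 0) * lam ^ θ = 2 / π * M := by
    rw [latticeGreen_origin hlam, hMeq]
    ring
  have hG := latticeGreen_origin_pos (a := 4 + lam) (by linarith)
  have hMpos : 0 < M := by
    have : 0 < 2 / π * M := hGM ▸ by positivity
    exact pos_of_mul_pos_right this (by positivity)
  refine ⟨M, hM, fun u hu => ?_, fun C hC => ?_⟩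
  · have hbound {mu : ℝ} (hmu : 0 < mu) := sq_origin_le_latticeGreen_mul_energy hmu hu
    have hN : 0 ≤ ∑' p : ℤ × ℤ, u p ^ 2 := tsum_nonneg fun p => sq_nonneg _
    have hD : 0 ≤ ∑' p : ℤ × ℤ,
        ((u (p.1 + 1, p.2) - u p) ^ 2 + (u (p.1, p.2 + 1) - u p) ^ 2) :=
      tsum_nonneg fun p => by positivity
    have hu0 : u (0, 0) ^ 2 ≤ ∑' p : ℤ × ℤ, u p ^ 2 := hu.le_tsum (0, 0) fun p _ => sq_nonneg _
    set N := ∑' p : ℤ × ℤ, u p ^ 2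
    set D := ∑' p : ℤ × ℤ, ((u (p.1 + 1, p.2) - u p) ^ 2 + (u (p.1, p.2 + 1) - u p) ^ 2)
    have hmain {mu : ℝ} (hmu : 0 < mu) :
        u (0, 0) ^ 2 ≤ 2 / π * M * ((mu * N + D) / mu ^ θ) := by
      refine (hbound hmu).trans ?_
      have hle : latticeGreen (4 + mu) (0, 0) * mu ^ θ ≤ 2 / π * M := by
        rw [latticeGreen_origin hmu]
        calc _ = 2 / π * (mu ^ θ * ellipticK (4 / (4 + mu)) / (4 + mu)) := by ring
          _ ≤ _ := by
            gcongr
            exact hM.2 ⟨mu, hmu, rfl⟩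
      calc _ = latticeGreen (4 + mu) (0, 0) * mu ^ θ * ((mu * N + D) / mu ^ θ) := by field_simp
        _ ≤ _ := by gcongr
    rcases hN.eq_or_lt with hN0 | hNpos
    · rw [← hN0] at hu0
      exact hu0.trans (by positivity)
    rcases hD.eq_or_lt with hD0 | hDpos
    · have hlim : Filter.Tendsto (fun mu : ℝ => 2 / π * M * (mu ^ (1 - θ) * N))
          (nhdsWithin 0 (Set.Ioi 0)) (nhds 0) := by
        have := (continuousAt_rpow_const 0 (1 - θ) (Or.inr h1.le)).tendsto
        rw [zero_rpow h1.ne'] at this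
        simpa using ((this.mono_left nhdsWithin_le_nhds).mul_const N).const_mul (2 / π * M)
      have hle : u (0, 0) ^ 2 ≤ 0 := by
        refine ge_of_tendsto hlim ?_
        filter_upwards [self_mem_nhdsWithin] with mu hmu
        have hmu : 0 < mu := hmu
        refine (hmain hmu).trans_eq ?_
        rw [← hD0, rpow_sub hmu, rpow_one]
        ring
      exact hle.trans (by positivity)
    · refine (hmain (mu := θ * D / ((1 - θ) * N)) (by positivity)).trans_eq ?_
      rw [energy_optimal hθ hNpos hDpos]
      ring
  · have hC' := hC _ (summable_latticeGreen_sq (a := 4 + lam) (by linarith))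
    have hN : 0 ≤ ∑' p : ℤ × ℤ, latticeGreen (4 + lam) p ^ 2 := tsum_nonneg fun p => sq_nonneg _
    have hD : 0 ≤ ∑' p : ℤ × ℤ,
        ((latticeGreen (4 + lam) (p.1 + 1, p.2) - latticeGreen (4 + lam) p) ^ 2 +
          (latticeGreen (4 + lam) (p.1, p.2 + 1) - latticeGreen (4 + lam) p) ^ 2) :=
      tsum_nonneg fun p => by positivity
    have hAG := rpow_mul_rpow_le_energy hθ hN hD hlam
    rw [energy_latticeGreen hlam] at hAG
    rw [mul_assoc] at hC'
    set G := latticeGreen (4 + lam) (0, 0)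
    have hCpos : 0 < C := pos_of_mul_pos_left ((by positivity : 0 < G ^ 2).trans_le hC')
      (by positivity)
    have hle : G ^ 2 ≤ C * (θ ^ θ * (1 - θ) ^ (1 - θ) * G / lam ^ θ) :=
      hC'.trans (by gcongr)
    rw [← mul_div_assoc, le_div_iff₀ (by positivity)] at hle
    have hfinal : G * lam ^ θ ≤ C * (θ ^ θ * (1 - θ) ^ (1 - θ)) := by
      refine le_of_mul_le_mul_left ?_ hG
      linarith
    rw [hGM] at hfinal
    rw [mul_right_comm, mul_one_div, div_le_iff₀ (by positivity)]
    exact hfinal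
end

section
/- Let K₂(θ) := (2/π)·(1/(θ^θ·(1−θ)^{1−θ}))·sup_{λ>0} [ λ^θ·K(4/(4+λ))/(4+λ) ] for θ ∈ (0,1), where K is the complete elliptic integral of the first kind. Then θ·K₂(θ) → 1/(4πe) as θ → 0⁺; that is, K₂(θ) = 1/(4πeθ) + o(1/θ) as θ → 0⁺. -/
open Real

/-- An explicit antiderivative of a majorant of the integrand of `ellipticK`. -/
noncomputable def ellipticMajorant (k t : ℝ) : ℝ :=
  -(1 / √k) * Real.log (√k * √(1 - t) + √(1 - k * t)) - √(1 - t)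

lemma hasDerivAt_ellipticMajorant {k t : ℝ} (hk0 : 0 < k) (hk1 : k < 1)
    (ht1 : t < 1) :
    HasDerivAt (ellipticMajorant k)
      (1 / (2 * √(1 - t) * √(1 - k * t)) + 1 / (2 * √(1 - t))) t := by
  have hkt : 0 < 1 - k * t := by nlinarith
  have h1t : 0 < 1 - t := by linarith
  have ha : 0 < √(1 - t) := Real.sqrt_pos.2 h1t
  have hb : 0 < √(1 - k * t) := Real.sqrt_pos.2 hkt
  have hc : 0 < √k := Real.sqrt_pos.2 hk0
  have da : HasDerivAt (fun t => √(1 - t)) (-1 / (2 * √(1 - t))) t :=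
    ((hasDerivAt_id t).const_sub 1).sqrt h1t.ne'
  have db : HasDerivAt (fun t => √(1 - k * t)) (-(k * 1) / (2 * √(1 - k * t))) t :=
    (((hasDerivAt_id t).const_mul k).const_sub 1).sqrt hkt.ne'
  have hs : √k * √(1 - t) + √(1 - k * t) ≠ 0 := by positivity
  have h := ((((da.const_mul (√k)).add db).log hs).const_mul (-(1 / √k))).sub da
  refine h.congr_deriv ?_
  simp only [Pi.add_apply]
  have hck : k = √k * √k := (Real.mul_self_sqrt hk0.le).symm
  generalize √(1 - t) = a at *
  generalize √(1 - k * t) = b at *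
  generalize √k = c at *
  subst hck
  field_simp
  ring

lemma continuousOn_ellipticMajorant {k : ℝ} (hk0 : 0 < k) (hk1 : k < 1) :
    ContinuousOn (ellipticMajorant k) (Set.Icc 0 1) := by
  unfold ellipticMajorant
  refine ContinuousOn.sub (ContinuousOn.mul continuousOn_const (ContinuousOn.log ?_ ?_)) ?_
  · fun_prop
  · rintro t ⟨h0, h1⟩
    have : 0 < √(1 - k * t) := Real.sqrt_pos.2 (by nlinarith)
    positivity
  · fun_prop

lemma ellipticK_integrand_le {k t : ℝ} (hk0 : 0 < k) (hk1 : k < 1) (ht0 : 0 < t)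
    (ht1 : t < 1) :
    1 / √((1 - t ^ 2) * (1 - k ^ 2 * t ^ 2)) ≤
      1 / (2 * √(1 - t) * √(1 - k * t)) + 1 / (2 * √(1 - t)) := by
  have hkt : 0 < 1 - k * t := by nlinarith
  have hkt0 : 0 < k * t := by positivity
  have h1t : 0 < 1 - t := by linarith
  have ha : 0 < √(1 - t) := Real.sqrt_pos.2 h1t
  have hb : 0 < √(1 - k * t) := Real.sqrt_pos.2 hkt
  have hb1 : 1 - k * t ≤ √(1 - k * t) := by
    apply Real.le_sqrt_of_sq_le
    nlinarith
  have hlow : √(1 - t) * √(1 - k * t) * (1 + k * t) ≤ √((1 - t ^ 2) * (1 - k ^ 2 * t ^ 2)) := by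
    apply Real.le_sqrt_of_sq_le
    rw [mul_pow, mul_pow, Real.sq_sqrt h1t.le, Real.sq_sqrt hkt.le]
    have : (1 - t ^ 2) * (1 - k ^ 2 * t ^ 2) =
        (1 - t) * (1 - k * t) * ((1 + t) * (1 + k * t)) := by ring
    have hkt1 : k * t ≤ t := by nlinarith
    rw [this, sq (1 + k * t)]
    gcongr
  calc 1 / √((1 - t ^ 2) * (1 - k ^ 2 * t ^ 2))
      ≤ 1 / (√(1 - t) * √(1 - k * t) * (1 + k * t)) :=
        one_div_le_one_div_of_le (by positivity) hlow
    _ ≤ (1 + √(1 - k * t)) / (2 * √(1 - t) * √(1 - k * t)) := by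
        rw [div_le_div_iff₀ (by positivity) (by positivity)]
        have : 2 ≤ (1 + √(1 - k * t)) * (1 + k * t) := by nlinarith
        nlinarith [mul_pos ha hb]
    _ = _ := by field_simp

lemma le_ellipticK_integrand {k t : ℝ} (hk0 : 0 < k) (hk1 : k < 1) (ht0 : 0 < t)
    (ht1 : t < 1) :
    1 / (2 * (1 - k * t)) ≤ 1 / √((1 - t ^ 2) * (1 - k ^ 2 * t ^ 2)) := by
  have hkt : 0 < 1 - k * t := by nlinarith
  have hkt0 : 0 < k * t := by positivity
  have hq : 0 < 1 - k ^ 2 * t ^ 2 := by nlinarith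
  have ht2 : 0 < 1 - t ^ 2 := by nlinarith
  refine one_div_le_one_div_of_le (Real.sqrt_pos.2 (mul_pos ht2 hq)) ?_
  apply Real.sqrt_le_iff.2 ⟨by positivity, ?_⟩
  have hk2 : k ^ 2 ≤ 1 := by nlinarith
  have h1 : 1 - t ^ 2 ≤ 1 - k ^ 2 * t ^ 2 := by nlinarith [sq_nonneg t]
  have h2 : 1 - k ^ 2 * t ^ 2 ≤ 2 * (1 - k * t) := by nlinarith [sq_nonneg (1 - k * t)]
  calc (1 - t ^ 2) * (1 - k ^ 2 * t ^ 2)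
      ≤ (2 * (1 - k * t)) * (2 * (1 - k * t)) := by
        apply mul_le_mul (h1.trans h2) h2 hq.le (by positivity)
    _ = _ := by ring

lemma intervalIntegrable_ellipticMajorant_deriv {k : ℝ} (hk0 : 0 < k) (hk1 : k < 1) :
    IntervalIntegrable (fun t => 1 / (2 * √(1 - t) * √(1 - k * t)) + 1 / (2 * √(1 - t)))
      MeasureTheory.volume 0 1 := by
  rw [intervalIntegrable_iff_integrableOn_Ioc_of_le zero_le_one]
  refine intervalIntegral.integrableOn_deriv_of_nonneg (continuousOn_ellipticMajorant hk0 hk1)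
    (fun t ht => hasDerivAt_ellipticMajorant hk0 hk1 ht.2) (fun t _ => by positivity)

lemma intervalIntegrable_ellipticK_integrand {k : ℝ} (hk0 : 0 < k) (hk1 : k < 1) :
    IntervalIntegrable (fun t => 1 / √((1 - t ^ 2) * (1 - k ^ 2 * t ^ 2)))
      MeasureTheory.volume 0 1 := by
  have h := intervalIntegrable_ellipticMajorant_deriv hk0 hk1
  rw [intervalIntegrable_iff_integrableOn_Ioo_of_le zero_le_one] at h ⊢
  refine h.mono' (Measurable.aestronglyMeasurable (by fun_prop)) ?_
  filter_upwards [MeasureTheory.ae_restrict_mem measurableSet_Ioo] with t ht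
  rw [Real.norm_of_nonneg (by positivity)]
  exact ellipticK_integrand_le hk0 hk1 ht.1 ht.2

lemma ellipticK_le {k : ℝ} (hk0 : 0 < k) (hk1 : k < 1) :
    ellipticK k ≤ 1 / (2 * √k) * Real.log (4 / (1 - k)) + 1 := by
  have hc : 0 < √k := Real.sqrt_pos.2 hk0
  have hc1 : √k ≤ 1 := Real.sqrt_le_one.2 hk1.le
  have hint : ∫ t in (0 : ℝ)..1, (1 / (2 * √(1 - t) * √(1 - k * t)) + 1 / (2 * √(1 - t))) =
      ellipticMajorant k 1 - ellipticMajorant k 0 :=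
    intervalIntegral.integral_eq_sub_of_hasDerivAt_of_le zero_le_one
      (continuousOn_ellipticMajorant hk0 hk1)
      (fun t ht => hasDerivAt_ellipticMajorant hk0 hk1 ht.2)
      (intervalIntegrable_ellipticMajorant_deriv hk0 hk1)
  have hle : ellipticK k ≤ ellipticMajorant k 1 - ellipticMajorant k 0 := by
    rw [← hint]
    exact intervalIntegral.integral_mono_on_of_le_Ioo zero_le_one
      (intervalIntegrable_ellipticK_integrand hk0 hk1)
      (intervalIntegrable_ellipticMajorant_deriv hk0 hk1)
      (fun t ht => ellipticK_integrand_le hk0 hk1 ht.1 ht.2)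
  have hval : ellipticMajorant k 1 - ellipticMajorant k 0 =
      1 / (2 * √k) * (2 * Real.log (√k + 1) - Real.log (1 - k)) + 1 := by
    simp only [ellipticMajorant, sub_self, Real.sqrt_zero, mul_zero, mul_one, sub_zero,
      Real.sqrt_one, zero_add]
    rw [Real.log_sqrt (by linarith)]
    field_simp
    ring
  have hlog : 2 * Real.log (√k + 1) ≤ Real.log 4 := by
    rw [show (4 : ℝ) = 2 ^ 2 by norm_num, Real.log_pow]
    push_cast
    gcongr
    linarith
  rw [hval] at hle
  refine hle.trans ?_
  rw [Real.log_div (by norm_num) (by linarith)]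
  gcongr

lemma le_ellipticK {k : ℝ} (hk0 : 0 < k) (hk1 : k < 1) :
    1 / 2 * Real.log (1 / (1 - k)) ≤ ellipticK k := by
  have hpos : ∀ t ∈ Set.uIcc (0 : ℝ) 1, 0 < 1 - k * t := by
    intro t ht
    rw [Set.uIcc_of_le zero_le_one] at ht
    nlinarith [ht.1, ht.2]
  have hcont : ContinuousOn (fun t => 1 / (2 * (1 - k * t))) (Set.uIcc (0 : ℝ) 1) :=
    ContinuousOn.div continuousOn_const (by fun_prop)
      (fun t ht => by have := hpos t ht; positivity)
  have hint : ∫ t in (0 : ℝ)..1, 1 / (2 * (1 - k * t)) =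
      -(1 / (2 * k)) * Real.log (1 - k * 1) - -(1 / (2 * k)) * Real.log (1 - k * 0) := by
    refine intervalIntegral.integral_eq_sub_of_hasDerivAt
      (f := fun t => -(1 / (2 * k)) * Real.log (1 - k * t)) (fun t ht => ?_)
      hcont.intervalIntegrable
    have hp := hpos t ht
    refine (((((hasDerivAt_id t).const_mul k).const_sub 1).log hp.ne').const_mul
      (-(1 / (2 * k)))).congr_deriv ?_
    simp only [id]
    field_simp
  have hle : ∫ t in (0 : ℝ)..1, 1 / (2 * (1 - k * t)) ≤ ellipticK k :=
    intervalIntegral.integral_mono_on_of_le_Ioo zero_le_one hcont.intervalIntegrable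
      (intervalIntegrable_ellipticK_integrand hk0 hk1)
      (fun t ht => le_ellipticK_integrand hk0 hk1 ht.1 ht.2)
  refine le_trans ?_ hle
  rw [hint]
  have hl : Real.log (1 - k) ≤ 0 := Real.log_nonpos (by linarith) (by linarith)
  have hk : 1 / 2 ≤ 1 / (2 * k) := one_div_le_one_div_of_le (by positivity) (by linarith)
  simp only [one_div, Real.log_inv, mul_one, mul_zero, sub_zero, Real.log_one] at *
  nlinarith

lemma rpow_mul_neg_log_le {lam θ : ℝ} (hl : 0 < lam) (hθ : 0 < θ) :
    lam ^ θ * -Real.log lam ≤ 1 / (θ * Real.exp 1) := by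
  rw [Real.rpow_def_of_pos hl, le_div_iff₀ (by positivity)]
  set u := -(Real.log lam * θ) with hu
  have h := Real.add_one_le_exp (u - 1)
  have h2 : Real.exp (Real.log lam * θ) * Real.exp 1 * Real.exp (u - 1) = 1 := by
    rw [← Real.exp_add, ← Real.exp_add, hu]
    simp
  calc Real.exp (Real.log lam * θ) * -Real.log lam * (θ * Real.exp 1)
      = Real.exp (Real.log lam * θ) * Real.exp 1 * u := by rw [hu]; ring
    _ ≤ Real.exp (Real.log lam * θ) * Real.exp 1 * Real.exp (u - 1) := by
        gcongr
        linarith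
    _ = 1 := h2

lemma rpow_mul_ellipticK_div_le {lam θ : ℝ} (hl : 0 < lam) (hθ : 0 < θ) (hθ2 : θ ≤ 1 / 2) :
    lam ^ θ * ellipticK (4 / (4 + lam)) / (4 + lam) ≤
      1 / (8 * Real.exp 1 * θ) + (Real.log 20 + 1) := by
  have h4 : 0 < 4 + lam := by linarith
  have hs : 0 < √(4 + lam) := Real.sqrt_pos.2 h4
  have hss : √(4 + lam) * √(4 + lam) = 4 + lam := Real.mul_self_sqrt h4.le
  have hs2 : 2 ≤ √(4 + lam) := Real.le_sqrt_of_sq_le (by linarith)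
  have hk := ellipticK_le (k := 4 / (4 + lam)) (by positivity)
    (by rw [div_lt_one h4]; linarith)
  have hsq : √(4 / (4 + lam)) = 2 / √(4 + lam) := by
    rw [Real.sqrt_div (by norm_num), show (4 : ℝ) = 2 ^ 2 by norm_num, Real.sqrt_sq (by norm_num)]
  have hlog : 4 / (1 - 4 / (4 + lam)) = (16 + 4 * lam) / lam := by
    have : 1 - 4 / (4 + lam) = lam / (4 + lam) := by field_simp; ring
    rw [this]
    field_simp
    ring
  rw [hsq, hlog] at hk
  have hp : 0 < lam ^ θ := Real.rpow_pos_of_pos hl θ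
  have hl20 : 0 ≤ Real.log 20 := Real.log_nonneg (by norm_num)
  have hK : lam ^ θ * ellipticK (4 / (4 + lam)) / (4 + lam) ≤
      lam ^ θ * Real.log ((16 + 4 * lam) / lam) / (4 * √(4 + lam)) + lam ^ θ / (4 + lam) := by
    calc _ ≤ lam ^ θ * (1 / (2 * (2 / √(4 + lam))) * Real.log ((16 + 4 * lam) / lam) + 1)
          / (4 + lam) := by gcongr
      _ = _ := by
        generalize √(4 + lam) = s at *
        rw [← hss]
        field_simp
        ring
  refine hK.trans ?_
  rcases le_total lam 1 with h1 | h1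
  · have hp1 : lam ^ θ ≤ 1 := Real.rpow_le_one hl.le h1 hθ.le
    have hA : lam ^ θ * Real.log ((16 + 4 * lam) / lam) ≤
        1 / (θ * Real.exp 1) + Real.log 20 := by
      rw [Real.log_div (by positivity) hl.ne']
      have h2 : Real.log (16 + 4 * lam) ≤ Real.log 20 := by gcongr; linarith
      have h3 := rpow_mul_neg_log_le hl hθ
      nlinarith
    have hB : lam ^ θ * Real.log ((16 + 4 * lam) / lam) / (4 * √(4 + lam)) ≤
        (1 / (θ * Real.exp 1) + Real.log 20) / 8 := by
      gcongr
      linarith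
    have hC : lam ^ θ / (4 + lam) ≤ 1 := by
      rw [div_le_one h4]
      linarith
    have : 1 / (8 * Real.exp 1 * θ) = 1 / (θ * Real.exp 1) / 8 := by field_simp
    linarith
  · have hps : lam ^ θ ≤ √(4 + lam) := by
      rw [Real.sqrt_eq_rpow]
      calc lam ^ θ ≤ lam ^ (1 / 2 : ℝ) := Real.rpow_le_rpow_of_exponent_le h1 hθ2
        _ ≤ _ := Real.rpow_le_rpow hl.le (by linarith) (by norm_num)
    have hA : Real.log ((16 + 4 * lam) / lam) ≤ Real.log 20 := by
      gcongr
      rw [div_le_iff₀ hl]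
      linarith
    have hB : lam ^ θ * Real.log ((16 + 4 * lam) / lam) / (4 * √(4 + lam)) ≤ Real.log 20 := by
      calc _ ≤ lam ^ θ * Real.log 20 / (4 * √(4 + lam)) := by gcongr
        _ ≤ √(4 + lam) * Real.log 20 / (4 * √(4 + lam)) := by gcongr
        _ = Real.log 20 / 4 := by field_simp
        _ ≤ _ := by linarith
    have hC : lam ^ θ / (4 + lam) ≤ 1 := by
      rw [div_le_one h4]
      nlinarith
    have : 0 < 1 / (8 * Real.exp 1 * θ) := by positivity
    linarith

lemma tendsto_mul_sSup_rpow_mul_ellipticK :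
    Filter.Tendsto
      (fun θ : ℝ => θ * sSup {y : ℝ | ∃ lam : ℝ, 0 < lam ∧
          y = lam ^ θ * ellipticK (4 / (4 + lam)) / (4 + lam)})
      (nhdsWithin 0 (Set.Ioi 0)) (nhds (1 / (8 * Real.exp 1))) := by
  have hev : ∀ᶠ θ : ℝ in nhdsWithin 0 (Set.Ioi 0), 0 < θ ∧ θ ≤ 1 / 2 := by
    filter_upwards [Ioc_mem_nhdsGT (show (0 : ℝ) < 1 / 2 by norm_num)] with θ h using h
  have hlow : Filter.Tendsto (fun θ : ℝ => 1 / (2 * Real.exp 1 * (4 + Real.exp (-θ⁻¹))))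
      (nhdsWithin 0 (Set.Ioi 0)) (nhds (1 / (8 * Real.exp 1))) := by
    have h0 : Filter.Tendsto (fun θ : ℝ => Real.exp (-θ⁻¹)) (nhdsWithin 0 (Set.Ioi 0))
        (nhds 0) :=
      Real.tendsto_exp_neg_atTop_nhds_zero.comp tendsto_inv_nhdsGT_zero
    have h1 := (tendsto_const_nhds (x := (1 : ℝ))).div
      ((h0.const_add 4).const_mul (2 * Real.exp 1)) (by positivity)
    rwa [show 2 * Real.exp 1 * (4 + 0) = 8 * Real.exp 1 by ring] at h1
  have hup : Filter.Tendsto (fun θ : ℝ => 1 / (8 * Real.exp 1) + θ * (Real.log 20 + 1))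
      (nhdsWithin 0 (Set.Ioi 0)) (nhds (1 / (8 * Real.exp 1))) := by
    have h : Filter.Tendsto (fun θ : ℝ => 1 / (8 * Real.exp 1) + θ * (Real.log 20 + 1))
        (nhds 0) (nhds (1 / (8 * Real.exp 1) + 0 * (Real.log 20 + 1))) :=
      Continuous.tendsto (by fun_prop) 0
    rw [zero_mul, add_zero] at h
    exact h.mono_left nhdsWithin_le_nhds
  refine tendsto_of_tendsto_of_tendsto_of_le_of_le' hlow hup ?_ ?_
  · filter_upwards [hev] with θ ⟨h0, h2⟩
    set lam := Real.exp (-θ⁻¹) with hlam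
    have hl : 0 < lam := Real.exp_pos _
    have hbdd : BddAbove {y : ℝ | ∃ lam : ℝ, 0 < lam ∧
        y = lam ^ θ * ellipticK (4 / (4 + lam)) / (4 + lam)} := by
      refine ⟨1 / (8 * Real.exp 1 * θ) + (Real.log 20 + 1), ?_⟩
      rintro y ⟨l, hl, rfl⟩
      exact rpow_mul_ellipticK_div_le hl h0 h2
    have hle := le_csSup hbdd ⟨lam, hl, rfl⟩
    have hpow : lam ^ θ = Real.exp (-1) := by
      rw [hlam, ← Real.exp_mul]
      congr 1
      field_simp
    have hK : 1 / 2 * θ⁻¹ ≤ ellipticK (4 / (4 + lam)) := by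
      refine le_trans ?_ (le_ellipticK (by positivity)
        (by rw [div_lt_one (by positivity)]; linarith))
      gcongr
      have h3 : 1 / (1 - 4 / (4 + lam)) = (4 + lam) / lam := by
        have : 1 - 4 / (4 + lam) = lam / (4 + lam) := by field_simp; ring
        rw [this, one_div_div]
      rw [h3, Real.le_log_iff_exp_le (by positivity), le_div_iff₀ hl, hlam, ← Real.exp_add]
      simp only [add_neg_cancel, Real.exp_zero]
      linarith
    calc 1 / (2 * Real.exp 1 * (4 + lam))
        = θ * (lam ^ θ * (1 / 2 * θ⁻¹) / (4 + lam)) := by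
          rw [hpow, Real.exp_neg]
          field_simp
      _ ≤ θ * (lam ^ θ * ellipticK (4 / (4 + lam)) / (4 + lam)) := by gcongr
      _ ≤ _ := by gcongr
  · filter_upwards [hev] with θ ⟨h0, h2⟩
    have hle : sSup {y : ℝ | ∃ lam : ℝ, 0 < lam ∧
        y = lam ^ θ * ellipticK (4 / (4 + lam)) / (4 + lam)} ≤
        1 / (8 * Real.exp 1 * θ) + (Real.log 20 + 1) := by
      refine csSup_le ⟨_, 1, one_pos, rfl⟩ ?_
      rintro y ⟨l, hl, rfl⟩
      exact rpow_mul_ellipticK_div_le hl h0 h2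
    calc _ ≤ θ * (1 / (8 * Real.exp 1 * θ) + (Real.log 20 + 1)) := by gcongr
      _ = _ := by field_simp

lemma tendsto_rpow_self_mul_one_sub_rpow_self :
    Filter.Tendsto (fun θ : ℝ => θ ^ θ * (1 - θ) ^ (1 - θ))
      (nhdsWithin 0 (Set.Ioi 0)) (nhds 1) := by
  have h1 : Filter.Tendsto (fun θ : ℝ => θ ^ θ) (nhdsWithin 0 (Set.Ioi 0)) (nhds 1) := by
    have h := (Real.continuous_exp.tendsto _).comp
      ((Real.continuous_mul_log.tendsto 0).mono_left
        (nhdsWithin_le_nhds (s := Set.Ioi (0 : ℝ))))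
    simp only [zero_mul, Real.exp_zero] at h
    refine h.congr' ?_
    filter_upwards [self_mem_nhdsWithin] with θ hθ
    rw [Real.rpow_def_of_pos hθ, Function.comp_apply, mul_comm]
  have h2 : Filter.Tendsto (fun θ : ℝ => (1 - θ) ^ (1 - θ)) (nhdsWithin 0 (Set.Ioi 0))
      (nhds 1) := by
    have hs : Filter.Tendsto (fun θ : ℝ => 1 - θ) (nhdsWithin 0 (Set.Ioi 0)) (nhds 1) := by
      have : Filter.Tendsto (fun θ : ℝ => 1 - θ) (nhds 0) (nhds (1 - 0)) :=
        Continuous.tendsto (by fun_prop) 0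
      rw [sub_zero] at this
      exact this.mono_left nhdsWithin_le_nhds
    simpa using hs.rpow hs (Or.inl one_ne_zero)
  simpa using h1.mul h2


/-- The sharp two-dimensional constant `K₂(θ)` satisfies
`θ K₂(θ) → 1/(4πe)` as `θ → 0⁺`, i.e. `K₂(θ) = 1/(4πeθ) + o(1/θ)`. -/
theorem K2_asymptotics :
    Filter.Tendsto
      (fun θ : ℝ => θ * ((2 / π) * (1 / (θ ^ θ * (1 - θ) ^ (1 - θ))) *
        sSup {y : ℝ | ∃ lam : ℝ, 0 < lam ∧
          y = lam ^ θ * ellipticK (4 / (4 + lam)) / (4 + lam)}))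
      (nhdsWithin 0 (Set.Ioi 0)) (nhds (1 / (4 * π * Real.exp 1))) := by
  have h := ((((tendsto_const_nhds (x := (1 : ℝ))).div
    tendsto_rpow_self_mul_one_sub_rpow_self one_ne_zero).const_mul (2 / π)).mul tendsto_mul_sSup_rpow_mul_ellipticK)
  convert h using 1
  · funext θ
    simp only [Pi.div_apply]
    ring
  · congr 1
    field_simp
    norm_num
end

section
/- Let d ≥ 3 and set K_d(0) := (1/(2π)^d)·∫_{[0,2π]^d} dx / (4·(sin²(x₁/2) + ⋯ + sin²(x_d/2))), which is a finite constant. Then for every u ∈ l²(ℤ^d), u(0)² ≤ K_d(0)·‖∇u‖². -/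
open Real MeasureTheory

theorem integrableOn_sq_sin_half_rpow {r : ℝ} (hr0 : 0 ≤ r) (hr : 2 * r < 1) :
    IntegrableOn (fun x : ℝ => (Real.sin (x / 2) ^ 2) ^ (-r)) (Set.Ioo 0 (2 * π)) := by
  have hpow : IntegrableOn (fun x : ℝ => x ^ (-(2 * r))) (Set.Ioo 0 (2 * π)) :=
    (intervalIntegral.integrableOn_Ioo_rpow_iff (by positivity)).2 (by linarith)
  have hrefl : IntegrableOn (fun x : ℝ => (2 * π - x) ^ (-(2 * r))) (Set.Ioo 0 (2 * π)) := by
    have h := (intervalIntegrable_iff_integrableOn_Ioo_of_le (by positivity)).2 hpow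
    have h' := h.comp_sub_left (2 * π)
    simp only [sub_zero, sub_self] at h'
    exact (intervalIntegrable_iff_integrableOn_Ioo_of_le (by positivity)).1 h'.symm
  refine Integrable.mono' ((hpow.const_mul (π ^ (2 * r))).add (hrefl.const_mul (π ^ (2 * r))))
    (show Measurable _ by fun_prop).aestronglyMeasurable ?_
  refine (ae_restrict_iff' measurableSet_Ioo).2 (.of_forall fun x hx => ?_)
  rw [Real.norm_of_nonneg (by positivity)]
  have hbound : ∀ y : ℝ, 0 < y → y / π ≤ Real.sin (x / 2) →
      (Real.sin (x / 2) ^ 2) ^ (-r) ≤ π ^ (2 * r) * y ^ (-(2 * r)) := by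
    intro y hy hys
    calc (Real.sin (x / 2) ^ 2) ^ (-r) ≤ ((y / π) ^ 2) ^ (-r) :=
          Real.rpow_le_rpow_of_nonpos (by positivity) (by gcongr) (by linarith)
      _ = (y / π) ^ (-(2 * r)) := by
          rw [← Real.rpow_natCast, ← Real.rpow_mul (by positivity)]; congr 1; push_cast; ring
      _ = π ^ (2 * r) * y ^ (-(2 * r)) := by
          rw [Real.div_rpow hy.le pi_pos.le, Real.rpow_neg pi_pos.le, div_inv_eq_mul, mul_comm]
  have hx0 : 0 < x := hx.1
  have hx1 : 0 < 2 * π - x := by linarith [hx.2]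
  simp only [Pi.add_apply]
  rcases le_total x π with h | h
  · have := mul_le_sin (x := x / 2) (by linarith) (by linarith)
    have := hbound x hx0 (le_trans (le_of_eq (by ring)) this)
    have : 0 ≤ π ^ (2 * r) * (2 * π - x) ^ (-(2 * r)) := by positivity
    linarith
  · have := mul_le_sin (x := π - x / 2) (by linarith) (by linarith)
    rw [Real.sin_pi_sub] at this
    have := hbound (2 * π - x) hx1 (le_trans (le_of_eq (by ring)) this)
    have : 0 ≤ π ^ (2 * r) * x ^ (-(2 * r)) := by positivity
    linarith

theorem one_div_sum_le_prod_rpow {ι : Type*} [Fintype ι] [Nonempty ι] (s : ι → ℝ)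
    (hs : ∀ i, 0 < s i) :
    1 / (4 * ∑ i, s i) ≤ ∏ i, s i ^ (-(1 / (Fintype.card ι : ℝ))) := by
  have hcard : (1 : ℝ) ≤ Fintype.card ι := by exact_mod_cast Fintype.card_pos
  have hamgm := Real.geom_mean_le_arith_mean_weighted Finset.univ
    (fun _ : ι => 1 / (Fintype.card ι : ℝ)) s (fun _ _ => by positivity)
    (by simp) (fun i _ => (hs i).le)
  have hprod : 0 < ∏ i, s i ^ (1 / (Fintype.card ι : ℝ)) :=
    Finset.prod_pos fun i _ => Real.rpow_pos_of_pos (hs i) _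
  simp only [Real.rpow_neg (hs _).le, Finset.prod_inv_distrib]
  rw [one_div]
  refine inv_anti₀ hprod (hamgm.trans ?_)
  rw [← Finset.mul_sum]
  have : 0 ≤ ∑ i, s i := Finset.sum_nonneg fun i _ => (hs i).le
  refine mul_le_mul_of_nonneg_right ?_ this
  rw [div_le_iff₀ (by positivity)]
  linarith

theorem integrableOn_one_div_sum_sq_sin_half (d : ℕ) (hd : 3 ≤ d) :
    IntegrableOn
      (fun x : Fin d → ℝ => 1 / (4 * ∑ j, Real.sin (x j / 2) ^ 2))
      (Set.univ.pi fun _ => Set.Icc 0 (2 * π)) := by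
  have : Nonempty (Fin d) := ⟨⟨0, by omega⟩⟩
  have hd' : (3 : ℝ) ≤ d := by exact_mod_cast hd
  have hprod : IntegrableOn
      (fun x : Fin d → ℝ => ∏ j, (Real.sin (x j / 2) ^ 2) ^ (-(1 / (d : ℝ))))
      (Set.univ.pi fun _ => Set.Ioo 0 (2 * π)) := by
    rw [IntegrableOn, volume_pi, Measure.restrict_pi_pi]
    refine Integrable.fintype_prod (f := fun _ x => (Real.sin (x / 2) ^ 2) ^ (-(1 / (d : ℝ))))
      fun _ => integrableOn_sq_sin_half_rpow (by positivity) ?_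
    rw [mul_one_div, div_lt_one (by positivity)]
    linarith
  have hset : (Set.univ.pi fun _ : Fin d => Set.Icc (0 : ℝ) (2 * π)) =ᵐ[volume]
      (Set.univ.pi fun _ => Set.Ioo 0 (2 * π)) := Measure.pi_Ioo_ae_eq_pi_Icc.symm
  rw [integrableOn_congr_set_ae hset]
  refine Integrable.mono' hprod (show Measurable _ by fun_prop).aestronglyMeasurable ?_
  refine (ae_restrict_iff' (MeasurableSet.univ_pi fun _ => measurableSet_Ioo)).2
    (.of_forall fun x hx => ?_)
  rw [Real.norm_of_nonneg (by positivity)]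
  have := one_div_sum_le_prod_rpow (fun j => Real.sin (x j / 2) ^ 2) fun j =>
    pow_pos (Real.sin_pos_of_pos_of_lt_pi (by linarith [(hx j trivial).1])
      (by linarith [(hx j trivial).2])) 2
  simpa using this

/-- The Cauchy–Schwarz inequality with a positive weight `w`. -/
theorem sq_integral_le_integral_one_div_mul {α : Type*} [MeasurableSpace α] {μ : Measure α}
    {w g : α → ℝ} (hw : ∀ᵐ t ∂μ, 0 < w t) (hg : Integrable g μ)
    (hw' : Integrable (fun t => 1 / w t) μ) (hwg : Integrable (fun t => w t * g t ^ 2) μ) :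
    (∫ t, g t ∂μ) ^ 2 ≤ (∫ t, 1 / w t ∂μ) * ∫ t, w t * g t ^ 2 ∂μ := by
  have hquad (s : ℝ) : 0 ≤ (∫ t, 1 / w t ∂μ) * (s * s) + (-2 * ∫ t, g t ∂μ) * s +
      ∫ t, w t * g t ^ 2 ∂μ := by
    have h : 0 ≤ ∫ t, 1 / w t * (s * s) + -2 * g t * s + w t * g t ^ 2 ∂μ := by
      refine integral_nonneg_of_ae ?_
      filter_upwards [hw] with t ht
      have : 1 / w t * (s * s) + -2 * g t * s + w t * g t ^ 2 = w t * (g t - s / w t) ^ 2 := by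
        field_simp
        ring
      rw [this]
      simp only [Pi.zero_apply]
      positivity
    have h1 : Integrable (fun t => 1 / w t * (s * s)) μ := hw'.mul_const _
    have h2 : Integrable (fun t => -2 * g t * s) μ := (hg.const_mul _).mul_const _
    have h12 : Integrable (fun t => 1 / w t * (s * s) + -2 * g t * s) μ := h1.add h2
    rwa [integral_add h12 hwg, integral_add h1 h2, integral_mul_const, integral_mul_const,
      integral_const_mul] at h
  have := discrim_le_zero hquad
  rw [discrim] at this
  linarith

open scoped Pointwise in
theorem smul_unitCube {ι : Type*} {c : ℝ} (hc : 0 < c) :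
    c • (Set.univ.pi fun _ : ι => Set.Icc (0 : ℝ) 1) =
      Set.univ.pi fun _ => Set.Icc (0 : ℝ) c := by
  rw [smul_univ_pi]
  congr 1
  ext i : 1
  simp [LinearOrderedField.smul_Icc hc]

section Torus

/-- The circle `ℝ / ℤ` carries its Haar probability measure. -/
noncomputable local instance haarUnitAddCircle : MeasureSpace UnitAddCircle :=
  ⟨AddCircle.haarAddCircle⟩

local instance : Measure.IsAddHaarMeasure (volume : Measure UnitAddCircle) :=
  inferInstanceAs (Measure.IsAddHaarMeasure AddCircle.haarAddCircle)

local instance : IsProbabilityMeasure (volume : Measure UnitAddCircle) :=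
  inferInstanceAs (IsProbabilityMeasure AddCircle.haarAddCircle)

local instance : NullSingletonClass (volume : Measure UnitAddCircle) where
  measure_singleton x := by
    have h := AddCircle.volume_closedBall (T := (1 : ℝ)) (x := x) 0
    have h2 : (volume : Measure UnitAddCircle) = (@volume _ (AddCircle.measureSpace 1)) := by
      rw [AddCircle.volume_eq_smul_haarAddCircle, ENNReal.ofReal_one, one_smul]
      rfl
    rw [h2]
    simpa using h

variable {ι : Type*} [Fintype ι]

/-- The Fourier symbol of minus the discrete Laplacian on `ι → ℤ`. -/
noncomputable def laplaceSymbol (t : UnitAddTorus ι) : ℝ :=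
  ∑ j, ‖(fourier 1 (t j) : ℂ) - 1‖ ^ 2

theorem continuous_laplaceSymbol : Continuous (laplaceSymbol (ι := ι)) := by
  unfold laplaceSymbol
  fun_prop

theorem laplaceSymbol_pos_ae [Nonempty ι] :
    ∀ᵐ t : UnitAddTorus ι, 0 < laplaceSymbol t := by
  obtain ⟨i⟩ := ‹Nonempty ι›
  have hnull : (volume : Measure (UnitAddTorus ι)) {t | t i = 0} = 0 :=
    Measure.pi_hyperplane (fun _ => (volume : Measure UnitAddCircle)) i 0
  have h : ∀ᵐ t : UnitAddTorus ι, t i ≠ 0 := by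
    rw [ae_iff]; simpa using hnull
  filter_upwards [h] with t ht
  refine Finset.sum_pos' (fun _ _ => by positivity) ⟨i, Finset.mem_univ _, ?_⟩
  have : (fourier 1 (t i) : ℂ) ≠ 1 := by
    rw [fourier_one]
    intro h1
    refine ht (AddCircle.injective_toCircle one_ne_zero ?_)
    rw [AddCircle.toCircle_zero]
    exact Circle.coe_eq_one.1 h1
  have := norm_pos_iff.2 (sub_ne_zero.2 this)
  positivity

theorem laplaceSymbol_coe (x : ι → ℝ) :
    laplaceSymbol (fun j => (x j : UnitAddCircle)) =
      4 * ∑ j, Real.sin (((2 * π) • x) j / 2) ^ 2 := by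
  unfold laplaceSymbol
  rw [Finset.mul_sum]
  refine Finset.sum_congr rfl fun j _ => ?_
  have : (fourier 1 (x j : UnitAddCircle) : ℂ) = Complex.exp (Complex.I * (2 * π * x j : ℝ)) := by
    rw [fourier_coe_apply]; congr 1; push_cast; ring
  rw [this, Complex.norm_exp_I_mul_ofReal_sub_one, Real.norm_eq_abs, sq_abs, mul_pow]
  norm_num

theorem exists_mFourierCoeff_eq (u : (ι → ℤ) → ℝ) (hu : Summable fun n => u n ^ 2) :
    ∃ f : Lp ℂ 2 (volume : Measure (UnitAddTorus ι)),
      ∀ n, UnitAddTorus.mFourierCoeff f n = (u n : ℂ) := by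
  have hmem : Memℓp (fun n => (u n : ℂ)) 2 := memℓp_gen (by simpa using hu)
  refine ⟨UnitAddTorus.mFourierBasis.repr.symm ⟨_, hmem⟩, fun n => ?_⟩
  have := UnitAddTorus.mFourierBasis_repr (UnitAddTorus.mFourierBasis.repr.symm ⟨_, hmem⟩) n
  rw [LinearIsometryEquiv.apply_symm_apply] at this
  exact this.symm

theorem hasSum_sq_mFourierCoeff_of_memLp {f : UnitAddTorus ι → ℂ} (hf : MemLp f 2 volume) :
    HasSum (fun n => ‖UnitAddTorus.mFourierCoeff f n‖ ^ 2) (∫ t, ‖f t‖ ^ 2) := by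
  have hae := hf.coeFn_toLp
  convert UnitAddTorus.hasSum_sq_mFourierCoeff (hf.toLp f) using 1
  · ext n
    congr 2
    refine integral_congr_ae ?_
    filter_upwards [hae] with t ht
    rw [ht]
  · refine integral_congr_ae ?_
    filter_upwards [hae] with t ht
    rw [ht]

/-- Parseval's identity for the `j`-th partial difference of the Fourier coefficients. -/
theorem hasSum_sq_partialDiff [DecidableEq ι] {f : UnitAddTorus ι → ℂ} (hf : MemLp f 2 volume)
    (j : ι) :
    Integrable (fun t => ‖(fourier 1 (t j) : ℂ) - 1‖ ^ 2 * ‖f t‖ ^ 2) ∧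
    HasSum (fun n => ‖UnitAddTorus.mFourierCoeff f (n + Pi.single j 1) -
        UnitAddTorus.mFourierCoeff f n‖ ^ 2)
      (∫ t, ‖(fourier 1 (t j) : ℂ) - 1‖ ^ 2 * ‖f t‖ ^ 2) := by
  have hint (m : ι → ℤ) : Integrable fun t => UnitAddTorus.mFourier m t * f t := by
    refine (hf.integrable one_le_two).bdd_mul (c := 1)
      (UnitAddTorus.mFourier m).continuous.aestronglyMeasurable (.of_forall fun t => ?_)
    exact ((UnitAddTorus.mFourier m).norm_coe_le_norm t).trans UnitAddTorus.mFourier_norm.le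
  set g : UnitAddTorus ι → ℂ :=
    fun t => (UnitAddTorus.mFourier (-Pi.single j 1) t - 1) * f t with hg
  have hnorm (t : UnitAddTorus ι) :
      ‖g t‖ ^ 2 = ‖(fourier 1 (t j) : ℂ) - 1‖ ^ 2 * ‖f t‖ ^ 2 := by
    rw [hg]
    simp only [norm_mul, mul_pow, UnitAddTorus.mFourier_neg, UnitAddTorus.mFourier_single]
    rw [← Complex.norm_conj]
    simp
  have hmem : MemLp g 2 volume := by
    refine hf.of_le_mul (c := 2) ?_ (.of_forall fun t => ?_)
    · exact (show Continuous fun t => UnitAddTorus.mFourier (-Pi.single j 1) t - 1 by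
        fun_prop).aestronglyMeasurable.mul hf.1
    · rw [norm_mul]
      gcongr
      refine (norm_sub_le _ _).trans ?_
      have := ((UnitAddTorus.mFourier (-Pi.single j 1)).norm_coe_le_norm t).trans
        UnitAddTorus.mFourier_norm.le
      rw [norm_one]
      linarith
  have hcoeff (n : ι → ℤ) : UnitAddTorus.mFourierCoeff g n =
      UnitAddTorus.mFourierCoeff f (n + Pi.single j 1) - UnitAddTorus.mFourierCoeff f n := by
    simp only [UnitAddTorus.mFourierCoeff, smul_eq_mul]
    rw [← integral_sub (hint _) (hint _)]
    refine integral_congr_ae (.of_forall fun t => ?_)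
    simp only [hg, neg_add, UnitAddTorus.mFourier_add]
    ring
  refine ⟨?_, ?_⟩
  · simpa only [hnorm] using (memLp_two_iff_integrable_sq_norm hmem.1).1 hmem
  · simpa only [hnorm, hcoeff] using hasSum_sq_mFourierCoeff_of_memLp hmem

theorem integrable_laplaceSymbol_mul_sq [DecidableEq ι] {f : UnitAddTorus ι → ℂ}
    (hf : MemLp f 2 volume) :
    Integrable (fun t => laplaceSymbol t * ‖f t‖ ^ 2) := by
  simp only [laplaceSymbol, Finset.sum_mul]
  exact integrable_finsetSum _ fun j _ => (hasSum_sq_partialDiff hf j).1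

theorem hasSum_sq_gradient [DecidableEq ι] {f : UnitAddTorus ι → ℂ} (hf : MemLp f 2 volume) :
    HasSum (fun n => ∑ j, ‖UnitAddTorus.mFourierCoeff f (n + Pi.single j 1) -
        UnitAddTorus.mFourierCoeff f n‖ ^ 2)
      (∫ t, laplaceSymbol t * ‖f t‖ ^ 2) := by
  simp only [laplaceSymbol, Finset.sum_mul]
  rw [integral_finsetSum _ fun j _ => (hasSum_sq_partialDiff hf j).1]
  exact hasSum_sum fun j _ => (hasSum_sq_partialDiff hf j).2


theorem pi_Ioc_ae_eq_unitCube :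
    {x : ι → ℝ | ∀ i, x i ∈ Set.Ioc (0 : ℝ) (0 + 1)} =ᵐ[volume]
      (Set.univ.pi fun _ => Set.Icc (0 : ℝ) 1) := by
  have : {x : ι → ℝ | ∀ i, x i ∈ Set.Ioc (0 : ℝ) (0 + 1)} =
      Set.univ.pi fun _ => Set.Ioc (0 : ℝ) 1 := by
    ext x; simp
  rw [this]
  exact Measure.pi_Ioc_ae_eq_pi_Icc

theorem integrable_one_div_laplaceSymbol
    (h : IntegrableOn (fun x : ι → ℝ => 1 / (4 * ∑ j, Real.sin (x j / 2) ^ 2))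
      (Set.univ.pi fun _ => Set.Icc 0 (2 * π))) :
    Integrable fun t : UnitAddTorus ι => 1 / laplaceSymbol t := by
  have hcube : MeasurableSet (Set.univ.pi fun _ : ι => Set.Icc (0 : ℝ) 1) :=
    MeasurableSet.univ_pi fun _ => measurableSet_Icc
  have hcube' : MeasurableSet (Set.univ.pi fun _ : ι => Set.Icc (0 : ℝ) (2 * π)) :=
    MeasurableSet.univ_pi fun _ => measurableSet_Icc
  have hscaled : IntegrableOn
      (fun x : ι → ℝ => 1 / laplaceSymbol (fun j => (x j : UnitAddCircle)))
      (Set.univ.pi fun _ => Set.Icc (0 : ℝ) 1) := by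
    rw [← integrable_indicator_iff hcube'] at h
    have h' := (integrable_comp_smul_iff volume _ two_pi_pos.ne').2 h
    rw [← integrable_indicator_iff hcube]
    refine h'.congr (.of_forall fun x => ?_)
    have hmem : (2 * π) • x ∈ (Set.univ.pi fun _ : ι => Set.Icc (0 : ℝ) (2 * π)) ↔
        x ∈ Set.univ.pi fun _ : ι => Set.Icc (0 : ℝ) 1 := by
      rw [← smul_unitCube two_pi_pos, Set.smul_mem_smul_set_iff₀ two_pi_pos.ne']
    beta_reduce
    by_cases hx : x ∈ Set.univ.pi fun _ : ι => Set.Icc (0 : ℝ) 1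
    · rw [Set.indicator_of_mem (hmem.2 hx), Set.indicator_of_mem hx, laplaceSymbol_coe]
    · rw [Set.indicator_of_notMem (mt hmem.1 hx), Set.indicator_of_notMem hx]
  refine ⟨(measurable_const.div continuous_laplaceSymbol.measurable).aestronglyMeasurable, ?_⟩
  rw [HasFiniteIntegral, UnitAddTorus.lintegral_preimage _ 0]
  simp only [Pi.zero_apply]
  rw [setLIntegral_congr pi_Ioc_ae_eq_unitCube]
  exact hscaled.2

theorem integral_one_div_laplaceSymbol :
    ∫ t : UnitAddTorus ι, 1 / laplaceSymbol t =
      1 / (2 * π) ^ Fintype.card ι *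
        ∫ x in Set.univ.pi fun _ : ι => Set.Icc (0 : ℝ) (2 * π),
          1 / (4 * ∑ j, Real.sin (x j / 2) ^ 2) := by
  rw [UnitAddTorus.integral_preimage _ 0]
  simp only [Pi.zero_apply]
  rw [setIntegral_congr_set pi_Ioc_ae_eq_unitCube]
  simp only [laplaceSymbol_coe]
  rw [Measure.setIntegral_comp_smul_of_pos volume
    (fun x : ι → ℝ => 1 / (4 * ∑ j, Real.sin (x j / 2) ^ 2)) _ two_pi_pos,
    smul_unitCube two_pi_pos, Module.finrank_fintype_fun_eq_card, smul_eq_mul, one_div]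

theorem sq_apply_zero_le_integral_mul_gradient [DecidableEq ι] [Nonempty ι]
    (h : Integrable fun t : UnitAddTorus ι => 1 / laplaceSymbol t)
    (u : (ι → ℤ) → ℝ) (hu : Summable fun n => u n ^ 2) :
    u 0 ^ 2 ≤ (∫ t : UnitAddTorus ι, 1 / laplaceSymbol t) *
      ∑' n : ι → ℤ, ∑ j, (u (n + Pi.single j 1) - u n) ^ 2 := by
  obtain ⟨f, hf⟩ := exists_mFourierCoeff_eq u hu
  have hmem : MemLp f 2 volume := Lp.memLp f
  have hgrad : HasSum (fun n : ι → ℤ => ∑ j, (u (n + Pi.single j 1) - u n) ^ 2)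
      (∫ t, laplaceSymbol t * ‖f t‖ ^ 2) := by
    simpa only [hf, ← Complex.ofReal_sub, Complex.norm_real, Real.norm_eq_abs, sq_abs] using
      hasSum_sq_gradient hmem
  have hzero : ∫ t, f t = (u 0 : ℂ) := by
    rw [← hf 0]
    simp [UnitAddTorus.mFourierCoeff, UnitAddTorus.mFourier_zero]
  have hle : |u 0| ≤ ∫ t, ‖f t‖ := by
    simpa [hzero] using norm_integral_le_integral_norm (μ := volume) f
  rw [hgrad.tsum_eq, ← sq_abs]
  calc |u 0| ^ 2 ≤ (∫ t, ‖f t‖) ^ 2 := by gcongr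
    _ ≤ _ := sq_integral_le_integral_one_div_mul laplaceSymbol_pos_ae
      (hmem.integrable one_le_two).norm h (integrable_laplaceSymbol_mul_sq hmem)

end Torus

/-- For `d ≥ 3`, the constant
`K_d(0) = (1/(2π)^d) ∫_{[0,2π]^d} dx/(4(sin²(x₁/2)+⋯+sin²(x_d/2)))` is finite
(the integrand is integrable) and `u(0)² ≤ K_d(0) ‖∇u‖²` for all `u ∈ l²(ℤ^d)`. -/
theorem limiting_inequality_high_dim (d : ℕ) (hd : 3 ≤ d) :
    IntegrableOn
      (fun x : Fin d → ℝ => 1 / (4 * ∑ j, Real.sin (x j / 2) ^ 2))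
      (Set.univ.pi fun _ => Set.Icc 0 (2 * π)) ∧
    ∀ u : (Fin d → ℤ) → ℝ, Summable (fun n => u n ^ 2) →
      u 0 ^ 2 ≤
        ((1 / (2 * π) ^ d) *
          ∫ x in Set.univ.pi fun _ : Fin d => Set.Icc (0 : ℝ) (2 * π),
            1 / (4 * ∑ j, Real.sin (x j / 2) ^ 2)) *
        (∑' n : Fin d → ℤ, ∑ j, (u (n + Pi.single j 1) - u n) ^ 2) := by
  have hint := integrableOn_one_div_sum_sq_sin_half d hd
  have : Nonempty (Fin d) := ⟨⟨0, by omega⟩⟩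
  refine ⟨hint, fun u hu => ?_⟩
  have h := sq_apply_zero_le_integral_mul_gradient (integrable_one_div_laplaceSymbol hint) u hu
  rwa [integral_one_div_laplaceSymbol, Fintype.card_fin] at h
end
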